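/- (Growth lemma, measure version.) Let n ≥ 1. There is a constant C depending only on n such that the following holds. Let ν be a finite signed Borel measure on ℝ^{n+1} with ‖∇_x W * ν‖_∞ ≤ 1 and ‖∂_t^{1/2}(W * ν)‖_{*,p} ≤ 1. Then for every parabolic cube Q ⊂ ℝ^{n+1} and every C² function φ admissible for Q, one has |∫ φ dν| ≤ C ℓ(Q)^{n+1}. -/

import Mathlib

open MeasureTheory Real Set

noncomputable section

/-- The spatial factor `ℝⁿ`. -/
abbrev Spc (n : ℕ) := EuclideanSpace ℝ (Fin n)

/-- The parabolic space `ℝ^{n+1} = ℝⁿ × ℝ`, points `x̄ = (x, t)`. -/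
abbrev Pt (n : ℕ) := Spc n × ℝ

/-- The parabolic norm `|x̄|_p = max (|x|, |t|^{1/2})`. -/
def pnorm {n : ℕ} (p : Pt n) : ℝ := max ‖p.1‖ (Real.sqrt |p.2|)

/-- The parabolic ball of center `c` and radius `r`. -/
def pball {n : ℕ} (c : Pt n) (r : ℝ) : Set (Pt n) := {p | pnorm (p - c) < r}

/-- The heat kernel `W`. -/
def heatW {n : ℕ} (p : Pt n) : ℝ :=
  if 0 < p.2 then (4 * π * p.2) ^ (-(n : ℝ) / 2) * Real.exp (-‖p.1‖ ^ 2 / (4 * p.2)) else 0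

/-- The spatial gradient `∇ₓ W` of the heat kernel. -/
def gradW {n : ℕ} (p : Pt n) : Spc n :=
  if 0 < p.2 then
    (-(1 / (2 * p.2)) * (4 * π * p.2) ^ (-(n : ℝ) / 2) * Real.exp (-‖p.1‖ ^ 2 / (4 * p.2))) • p.1
  else 0

/-- Half time derivative `∂_t^{1/2} f (x,t) = ∫ (f(x,s) - f(x,t))/|s-t|^{3/2} ds`. -/
def halfT {n : ℕ} (f : Pt n → ℝ) (p : Pt n) : ℝ :=
  ∫ s : ℝ, (f (p.1, s) - f p) / |s - p.2| ^ (3 / 2 : ℝ)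

/-- A parabolic cube: product of `n` intervals of length `len` and a time interval
of length `len ^ 2`. -/
structure PCube (n : ℕ) where
  corner : Fin n → ℝ
  time : ℝ
  len : ℝ
  len_pos : 0 < len

/-- The set of points of a parabolic cube. -/
def PCube.toSet {n : ℕ} (Q : PCube n) : Set (Pt n) :=
  {p | (∀ i, p.1 i ∈ Set.Icc (Q.corner i) (Q.corner i + Q.len)) ∧
    p.2 ∈ Set.Icc Q.time (Q.time + Q.len ^ 2)}

/-- The dilation `λQ` of a parabolic cube: same center, side lengths `λ·len` and
`λ²·len²`. -/
def PCube.dilate {n : ℕ} (Q : PCube n) (lam : ℝ) (h : 0 < lam) : PCube n :=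
  ⟨fun i => Q.corner i + Q.len / 2 - lam * Q.len / 2,
    Q.time + Q.len ^ 2 / 2 - lam ^ 2 * Q.len ^ 2 / 2,
    lam * Q.len, mul_pos h Q.len_pos⟩

/-- Second directional derivative in the `i`-th spatial direction. -/
def dir2 {n : ℕ} (φ : Pt n → ℝ) (p : Pt n) (i : Fin n) : ℝ :=
  deriv (fun h : ℝ =>
    deriv (fun h' : ℝ => φ (p.1 + h' • (EuclideanSpace.single i 1 : Spc n), p.2)) h) 0

/-- Spatial Laplacian `Δₓ φ`. -/
def lapx {n : ℕ} (φ : Pt n → ℝ) (p : Pt n) : ℝ := ∑ i : Fin n, dir2 φ p i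

/-- A `C²` function `φ` is admissible for a parabolic cube `Q` if it is supported on `Q`,
`‖∇ₓ φ‖_∞ ≤ 1/ℓ(Q)` and `‖Δₓ φ‖_∞ + ‖∂_t φ‖_∞ ≤ 1/ℓ(Q)²`. -/
def Admissible {n : ℕ} (φ : Pt n → ℝ) (Q : PCube n) : Prop :=
  ContDiff ℝ 2 φ ∧ tsupport φ ⊆ Q.toSet ∧
  (∀ p : Pt n, ‖fderiv ℝ (fun y : Spc n => φ (y, p.2)) p.1‖ ≤ 1 / Q.len) ∧
  (∀ p : Pt n, |lapx φ p| + |deriv (fun s : ℝ => φ (p.1, s)) p.2| ≤ 1 / Q.len ^ 2)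

/-- The parabolic BMO norm of `f` is at most `C`. -/
def ParabBMOLe {n : ℕ} (f : Pt n → ℝ) (C : ℝ) : Prop :=
  ∀ Q : PCube n, ⨍ p in Q.toSet, |f p - ⨍ q in Q.toSet, f q| ≤ C

/-- `‖F‖_{Lip_{1/2,t}} ≤ C` : half-Lipschitz in time. -/
def LipHalfLe {n : ℕ} (F : Pt n → ℝ) (C : ℝ) : Prop :=
  ∀ (x : Spc n) (t u : ℝ), |F (x, t) - F (x, u)| ≤ C * Real.sqrt |t - u|

/-- Integral of a scalar function against a finite signed measure. -/
def sInt {n : ℕ} (ν : SignedMeasure (Pt n)) (f : Pt n → ℝ) : ℝ :=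
  ∫ y, f y ∂ν.toJordanDecomposition.posPart - ∫ y, f y ∂ν.toJordanDecomposition.negPart

/-- Integral of a vector-valued function against a finite signed measure. -/
def vInt {n : ℕ} (ν : SignedMeasure (Pt n)) (f : Pt n → Spc n) : Spc n :=
  ∫ y, f y ∂ν.toJordanDecomposition.posPart - ∫ y, f y ∂ν.toJordanDecomposition.negPart

/-- `W * ν`. -/
def convW {n : ℕ} (ν : SignedMeasure (Pt n)) (p : Pt n) : ℝ :=
  sInt ν (fun y => heatW (p - y))

/-- `∇ₓ W * ν`. -/
def convGradW {n : ℕ} (ν : SignedMeasure (Pt n)) (p : Pt n) : Spc n :=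
  vInt ν (fun y => gradW (p - y))

/-- `W * (φ ν)`, where `φν` is the measure with density `φ` w.r.t. `ν`. -/
def convWd {n : ℕ} (ν : SignedMeasure (Pt n)) (φ : Pt n → ℝ) (p : Pt n) : ℝ :=
  sInt ν (fun y => φ y * heatW (p - y))

/-- `∇ₓ W * (φ ν)`. -/
def convGradWd {n : ℕ} (ν : SignedMeasure (Pt n)) (φ : Pt n → ℝ) (p : Pt n) : Spc n :=
  vInt ν (fun y => φ y • gradW (p - y))

/-- `W * μ` for a positive measure `μ`. -/
def mconvW {n : ℕ} (μ : Measure (Pt n)) (p : Pt n) : ℝ := ∫ y, heatW (p - y) ∂μ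

/-- `∇ₓ W * μ` for a positive measure `μ`. -/
def mconvGradW {n : ℕ} (μ : Measure (Pt n)) (p : Pt n) : Spc n := ∫ y, gradW (p - y) ∂μ

/-- Upper parabolic growth of degree `n+1` with constant `1`. -/
def PGrowth {n : ℕ} (μ : Measure (Pt n)) : Prop :=
  ∀ (c : Pt n) (r : ℝ), 0 < r → μ (pball c r) ≤ ENNReal.ofReal (r ^ (n + 1))

open Filter Topology
open scoped ENNReal

lemma rpow_n3 {a : ℝ} (ha : 0 < a) : a ^ (-3/2 : ℝ) = 1 / (a * √a) := by
  rw [show (-3/2 : ℝ) = -(1 + 1/2) by norm_num, Real.rpow_neg ha.le, Real.rpow_add ha,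
    Real.rpow_one, ← Real.sqrt_eq_rpow, one_div]

lemma rpow_n1 {a : ℝ} (ha : 0 ≤ a) : a ^ (-1/2 : ℝ) = 1 / √a := by
  rw [show (-1/2 : ℝ) = -(1/2) by norm_num, Real.rpow_neg ha, ← Real.sqrt_eq_rpow, one_div]

lemma key_alg {a y : ℝ} (ha : 0 < a) (hy : 0 < y) :
    a ^ (-3/2 : ℝ) * y ^ (-1/2 : ℝ) = 1 / (a ^ 2 * √(y / a)) := by
  rw [rpow_n3 ha, rpow_n1 hy.le, Real.sqrt_div hy.le]
  have h1 : 0 < √a := Real.sqrt_pos.2 ha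
  have h2 : 0 < √y := Real.sqrt_pos.2 hy
  have h3 : √a ^ 2 = a := Real.sq_sqrt ha.le
  field_simp
  nlinarith

lemma tendsto_sqrt_aux (r : ℝ) : Tendsto (fun a : ℝ => √(1 + r / a)) atTop (𝓝 1) := by
  have h : Tendsto (fun a : ℝ => 1 + r / a) atTop (𝓝 (1 + 0)) :=
    tendsto_const_nhds.add (tendsto_const_nhds.div_atTop tendsto_id)
  have := (Real.continuous_sqrt.tendsto _).comp h
  simpa [Function.comp_def] using this

lemma int_plus {r ε : ℝ} (hr : 0 < r) (hε : 0 < ε) :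
    IntegrableOn (fun a : ℝ => |a| ^ (-3/2 : ℝ) * |a + r| ^ (-1/2 : ℝ)) (Ioi ε) ∧
    ∫ a in Ioi ε, |a| ^ (-3/2 : ℝ) * |a + r| ^ (-1/2 : ℝ) = (2 / r) * (√(1 + r / ε) - 1) := by
  have hd : ∀ x ∈ Ici ε, HasDerivAt (fun a : ℝ => -(2 / r) * √(1 + r / a))
      (|x| ^ (-3/2 : ℝ) * |x + r| ^ (-1/2 : ℝ)) x := by
    intro x hx
    have hx0 : 0 < x := lt_of_lt_of_le hε hx
    rw [abs_of_pos hx0, abs_of_pos (by positivity : 0 < x + r), key_alg hx0 (by positivity)]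
    have h1 : HasDerivAt (fun a : ℝ => 1 + r / a) (-r / x ^ 2) x := by
      have := ((hasDerivAt_inv hx0.ne').const_mul r).const_add 1
      refine this.congr_deriv ?_
      ring
    have hpos : 0 < 1 + r / x := by positivity
    have h2 := (h1.sqrt hpos.ne').const_mul (-(2 / r))
    refine h2.congr_deriv ?_
    rw [show (x + r) / x = 1 + r / x by field_simp]
    have : 0 < √(1 + r / x) := Real.sqrt_pos.2 hpos
    field_simp
  have hn : ∀ x ∈ Ioi ε, 0 ≤ |x| ^ (-3/2 : ℝ) * |x + r| ^ (-1/2 : ℝ) := fun x _ => by positivity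
  have ht := (tendsto_sqrt_aux r).const_mul (-(2 / r))
  refine ⟨integrableOn_Ioi_deriv_of_nonneg' hd hn ht, ?_⟩
  rw [integral_Ioi_of_hasDerivAt_of_nonneg' hd hn ht]
  ring

lemma int_minus_lt {r ε : ℝ} (hr : 0 < r) (hε : r ≤ ε) :
    IntegrableOn (fun a : ℝ => |a| ^ (-3/2 : ℝ) * |a - r| ^ (-1/2 : ℝ)) (Ioi ε) ∧
    ∫ a in Ioi ε, |a| ^ (-3/2 : ℝ) * |a - r| ^ (-1/2 : ℝ) = (2 / r) * (1 - √(1 - r / ε)) := by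
  have hε0 : 0 < ε := lt_of_lt_of_le hr hε
  have hd : ∀ x ∈ Ioi ε, HasDerivAt (fun a : ℝ => (2 / r) * √(1 - r / a))
      (|x| ^ (-3/2 : ℝ) * |x - r| ^ (-1/2 : ℝ)) x := by
    intro x hx
    have hx0 : 0 < x := lt_trans hε0 hx
    have hxr : 0 < x - r := sub_pos.2 (lt_of_le_of_lt hε hx)
    rw [abs_of_pos hx0, abs_of_pos hxr, key_alg hx0 hxr]
    have h1 : HasDerivAt (fun a : ℝ => 1 - r / a) (r / x ^ 2) x := by
      have := ((hasDerivAt_inv hx0.ne').const_mul r).const_sub 1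
      refine this.congr_deriv ?_
      ring
    have hpos : 0 < 1 - r / x := by
      rw [show 1 - r / x = (x - r) / x by field_simp]; positivity
    have h2 := (h1.sqrt hpos.ne').const_mul (2 / r)
    refine h2.congr_deriv ?_
    rw [show (x - r) / x = 1 - r / x by field_simp]
    have : 0 < √(1 - r / x) := Real.sqrt_pos.2 hpos
    field_simp
  have hn : ∀ x ∈ Ioi ε, 0 ≤ |x| ^ (-3/2 : ℝ) * |x - r| ^ (-1/2 : ℝ) := fun x _ => by positivity
  have ht : Tendsto (fun a : ℝ => (2 / r) * √(1 - r / a)) atTop (𝓝 ((2 / r) * 1)) := by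
    have := (tendsto_sqrt_aux (-r)).const_mul (2 / r)
    refine this.congr fun a => ?_
    rw [neg_div, ← sub_eq_add_neg]
  have hc : ContinuousWithinAt (fun a : ℝ => (2 / r) * √(1 - r / a)) (Ici ε) ε := by
    apply ContinuousAt.continuousWithinAt
    have : ContinuousAt (fun a : ℝ => 1 - r / a) ε :=
      continuousAt_const.sub (continuousAt_const.div continuousAt_id hε0.ne')
    exact continuousAt_const.mul this.sqrt
  refine ⟨integrableOn_Ioi_deriv_of_nonneg hc hd hn ht, ?_⟩
  rw [integral_Ioi_of_hasDerivAt_of_nonneg hc hd hn ht]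
  ring

lemma int_minus_gt {r ε : ℝ} (hε : 0 < ε) (hr : ε < r) :
    IntegrableOn (fun a : ℝ => |a| ^ (-3/2 : ℝ) * |a - r| ^ (-1/2 : ℝ)) (Ioi ε) ∧
    ∫ a in Ioi ε, |a| ^ (-3/2 : ℝ) * |a - r| ^ (-1/2 : ℝ) = (2 / r) * (1 + √(r / ε - 1)) := by
  have hr0 : 0 < r := hε.trans hr
  obtain ⟨i1, e1⟩ := int_minus_lt hr0 (le_refl r)
  have hd : ∀ x ∈ Ioo ε r, HasDerivAt (fun a : ℝ => -(2 / r) * √(r / a - 1))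
      (|x| ^ (-3/2 : ℝ) * |x - r| ^ (-1/2 : ℝ)) x := by
    intro x hx
    have hx0 : 0 < x := hε.trans hx.1
    have hxr : 0 < r - x := sub_pos.2 hx.2
    rw [abs_of_pos hx0, abs_sub_comm, abs_of_pos hxr, key_alg hx0 hxr]
    have h1 : HasDerivAt (fun a : ℝ => r / a - 1) (-r / x ^ 2) x := by
      have := ((hasDerivAt_inv hx0.ne').const_mul r).sub_const 1
      refine this.congr_deriv ?_
      ring
    have hpos : 0 < r / x - 1 := by
      rw [show r / x - 1 = (r - x) / x by field_simp]; positivity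
    have h2 := (h1.sqrt hpos.ne').const_mul (-(2 / r))
    refine h2.congr_deriv ?_
    rw [show (r - x) / x = r / x - 1 by field_simp]
    have : 0 < √(r / x - 1) := Real.sqrt_pos.2 hpos
    field_simp
  have hn : ∀ x ∈ Ioo ε r, 0 ≤ |x| ^ (-3/2 : ℝ) * |x - r| ^ (-1/2 : ℝ) := fun x _ => by positivity
  have hc : ContinuousOn (fun a : ℝ => -(2 / r) * √(r / a - 1)) (Icc ε r) := by
    intro x hx
    apply ContinuousAt.continuousWithinAt
    have hx0 : 0 < x := lt_of_lt_of_le hε hx.1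
    have : ContinuousAt (fun a : ℝ => r / a - 1) x :=
      (continuousAt_const.div continuousAt_id hx0.ne').sub continuousAt_const
    exact continuousAt_const.mul this.sqrt
  have i2 := intervalIntegral.integrableOn_deriv_of_nonneg hc hd hn
  have e2 := intervalIntegral.integral_eq_sub_of_hasDeriv_right_of_le hr.le hc
    (fun x hx => (hd x hx).hasDerivWithinAt)
    ((intervalIntegrable_iff_integrableOn_Ioc_of_le hr.le).2 i2)
  rw [intervalIntegral.integral_of_le hr.le] at e2
  rw [← Ioc_union_Ioi_eq_Ioi hr.le]
  refine ⟨i2.union i1, ?_⟩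
  rw [setIntegral_union Ioc_disjoint_Ioi_same measurableSet_Ioi i2 i1, e1, e2]
  rw [div_self hr0.ne']
  simp
  ring

/-- explicit kernel -/
def kE (r : ℝ) : ℝ :=
  (2 / |r|) * (√(1 + |r|) - 2 * √|r| + (if |r| ≤ 1 then - √(1 - |r|) else √(|r| - 1)))

lemma int_three {ε : ℝ} (hε : 0 < ε) :
    IntegrableOn (fun a : ℝ => |a| ^ (-3/2 : ℝ)) (Ioi ε) ∧
    ∫ a in Ioi ε, |a| ^ (-3/2 : ℝ) = 2 / √ε := by
  have hc : EqOn (fun a : ℝ => a ^ (-3/2 : ℝ)) (fun a : ℝ => |a| ^ (-3/2 : ℝ)) (Ioi ε) := by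
    intro a ha
    simp only [abs_of_pos (hε.trans ha)]
  refine ⟨(integrableOn_Ioi_rpow_of_lt (by norm_num) hε).congr_fun hc measurableSet_Ioi, ?_⟩
  rw [← setIntegral_congr_fun measurableSet_Ioi hc, integral_Ioi_rpow_of_lt (by norm_num) hε]
  rw [show (-3/2 + 1 : ℝ) = -1/2 by norm_num, rpow_n1 hε.le]
  ring

lemma int_minus {r ε : ℝ} (hr : 0 < r) (hε : 0 < ε) :
    IntegrableOn (fun a : ℝ => |a| ^ (-3/2 : ℝ) * |a - r| ^ (-1/2 : ℝ)) (Ioi ε) ∧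
    ∫ a in Ioi ε, |a| ^ (-3/2 : ℝ) * |a - r| ^ (-1/2 : ℝ) = (2 / r) *
      (1 + (if r / ε ≤ 1 then - √(1 - r / ε) else √(r / ε - 1))) := by
  by_cases h : r ≤ ε
  · have : r / ε ≤ 1 := (div_le_one hε).2 h
    rw [if_pos this]
    simpa [sub_eq_add_neg] using int_minus_lt hr h
  · have : ¬ r / ε ≤ 1 := fun h' => h ((div_le_one hε).1 h')
    rw [if_neg this]
    exact int_minus_gt hε (not_le.1 h)

lemma set_abs (ε : ℝ) (hε : 0 < ε) : {a : ℝ | ε < |a|} = Ioi ε ∪ Iio (-ε) := by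
  ext a
  simp only [mem_ofPred_eq, mem_union, mem_Ioi, mem_Iio, lt_abs]
  constructor <;> rintro (h | h) <;> [left; right; left; right] <;> linarith

lemma integral_abs_gt {F : ℝ → ℝ} {ε : ℝ} (hε : 0 < ε)
    (h1 : IntegrableOn F (Ioi ε)) (h2 : IntegrableOn (fun a => F (-a)) (Ioi ε)) :
    IntegrableOn F {a : ℝ | ε < |a|} ∧
    ∫ a in {a : ℝ | ε < |a|}, F a = (∫ a in Ioi ε, F a) + ∫ a in Ioi ε, F (-a) := by
  have h3 : IntegrableOn F (Iio (-ε)) := by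
    have := (Measure.measurePreserving_neg (volume : Measure ℝ)).integrableOn_comp_preimage
      (Homeomorph.neg ℝ).measurableEmbedding (f := F) (s := Iio (-ε))
    rw [← this]
    have hs : (Neg.neg ⁻¹' Iio (-ε) : Set ℝ) = Ioi ε := by ext a; simp
    rw [hs]; exact h2
  rw [set_abs ε hε]
  refine ⟨h1.union h3, ?_⟩
  rw [setIntegral_union _ measurableSet_Iio h1 h3]
  · congr 1
    rw [integral_comp_neg_Ioi, integral_Iic_eq_integral_Iio]
  · rw [Set.disjoint_left]
    intro a h h'
    simp only [mem_Ioi, mem_Iio] at h h'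
    linarith

lemma kE_eq_pos {r ε : ℝ} (hr : 0 < r) (hε : 0 < ε) :
    IntegrableOn (fun a : ℝ => |a| ^ (-3/2 : ℝ) * (|a - r| ^ (-1/2 : ℝ) - |r| ^ (-1/2 : ℝ)))
      {a | ε < |a|} ∧
    ∫ a in {a : ℝ | ε < |a|}, |a| ^ (-3/2 : ℝ) * (|a - r| ^ (-1/2 : ℝ) - |r| ^ (-1/2 : ℝ))
      = ε⁻¹ * kE (r / ε) := by
  obtain ⟨i1, e1⟩ := int_plus hr hε
  obtain ⟨i2, e2⟩ := int_minus hr hε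
  obtain ⟨i3, e3⟩ := int_three hε
  have E1 : (fun a : ℝ => |a| ^ (-3/2 : ℝ) * (|a - r| ^ (-1/2 : ℝ) - |r| ^ (-1/2 : ℝ)))
    = fun a => |a| ^ (-3/2 : ℝ) * |a - r| ^ (-1/2 : ℝ) - |a| ^ (-3/2 : ℝ) * |r| ^ (-1/2 : ℝ) := by
    funext a; ring
  have E2 : (fun a : ℝ => |-a| ^ (-3/2 : ℝ) * (|-a - r| ^ (-1/2 : ℝ) - |r| ^ (-1/2 : ℝ)))
    = fun a => |a| ^ (-3/2 : ℝ) * |a + r| ^ (-1/2 : ℝ) - |a| ^ (-3/2 : ℝ) * |r| ^ (-1/2 : ℝ) := by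
    funext a
    rw [abs_neg, show -a - r = -(a + r) by ring, abs_neg]; ring
  have i3' := i3.mul_const (|r| ^ (-1/2 : ℝ))
  have j1 : IntegrableOn (fun a : ℝ => |a| ^ (-3/2 : ℝ) * (|a - r| ^ (-1/2 : ℝ) - |r| ^ (-1/2 : ℝ)))
      (Ioi ε) := by
    rw [E1]; exact i2.sub i3'
  have j2 : IntegrableOn (fun a : ℝ => |-a| ^ (-3/2 : ℝ) *
      (|-a - r| ^ (-1/2 : ℝ) - |r| ^ (-1/2 : ℝ))) (Ioi ε) := by
    rw [E2]; exact i1.sub i3'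
  obtain ⟨k1, k2⟩ := integral_abs_gt hε j1 j2
  refine ⟨k1, ?_⟩
  rw [k2, E1, E2, integral_sub i2 i3', integral_sub i1 i3', integral_mul_const, e1, e2, e3]
  have hy : 0 < r / ε := by positivity
  rw [kE, abs_of_pos hy, abs_of_pos hr, rpow_n1 hr.le, Real.sqrt_div hr.le]
  have h1 : 0 < √r := Real.sqrt_pos.2 hr
  have h2 : 0 < √ε := Real.sqrt_pos.2 hε
  have h3 : √r ^ 2 = r := Real.sq_sqrt hr.le
  generalize (if r / ε ≤ 1 then - √(1 - r / ε) else √(r / ε - 1)) = Y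
  generalize √(1 + r / ε) = Z
  rw [show (2 / r : ℝ) = 2 / √r ^ 2 by rw [h3]]
  rw [show (2 / (r / ε) : ℝ) = 2 * ε / √r ^ 2 by rw [h3]; field_simp]
  field_simp
  ring

lemma kE_neg (r : ℝ) : kE (-r) = kE r := by simp [kE]

lemma kE_eq {r ε : ℝ} (hr : r ≠ 0) (hε : 0 < ε) :
    ∫ a in {a : ℝ | ε < |a|}, |a| ^ (-3/2 : ℝ) * (|a - r| ^ (-1/2 : ℝ) - |r| ^ (-1/2 : ℝ))
      = ε⁻¹ * kE (r / ε) := by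
  rcases lt_or_gt_of_ne hr with h | h
  · have := (kE_eq_pos (neg_pos.2 h) hε).2
    rw [neg_div ε r, kE_neg] at this
    rw [← this]
    have e := (Measure.measurePreserving_neg (volume : Measure ℝ)).setIntegral_preimage_emb
      (Homeomorph.neg ℝ).measurableEmbedding
      (fun a : ℝ => |a| ^ (-3/2 : ℝ) * (|a - r| ^ (-1/2 : ℝ) - |r| ^ (-1/2 : ℝ))) {a : ℝ | ε < |a|}
    rw [← e]
    have hs : (Neg.neg ⁻¹' {a : ℝ | ε < |a|}) = {a : ℝ | ε < |a|} := by ext a; simp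
    rw [hs]
    congr 1
    funext a
    rw [abs_neg, abs_neg, show -a - r = -(a - -r) by ring, abs_neg]
  · exact (kE_eq_pos h hε).2

lemma kE_nonpos (r : ℝ) : kE r ≤ 0 := by
  unfold kE
  set y := |r| with hy
  have h0 : 0 ≤ y := abs_nonneg r
  apply mul_nonpos_of_nonneg_of_nonpos (by positivity)
  have hs : √y ^ 2 = y := Real.sq_sqrt h0
  have a1 : √(1 + y) ^ 2 = 1 + y := Real.sq_sqrt (by linarith)
  have p1 := Real.sqrt_nonneg (1 + y)
  have p2 := Real.sqrt_nonneg y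
  split_ifs with h
  · have a2 : √(1 - y) ^ 2 = 1 - y := Real.sq_sqrt (by linarith)
    have p3 := Real.sqrt_nonneg (1 - y)
    have hy1 : √y ≤ 1 := by nlinarith
    have : √(1 + y) ≤ √(1 - y) + 2 * √y := by
      apply abs_le_of_sq_le_sq' _ (by positivity) |>.2
      nlinarith [mul_nonneg p3 p2]
    linarith
  · push Not at h
    have a2 : √(y - 1) ^ 2 = y - 1 := Real.sq_sqrt (by linarith)
    have p3 := Real.sqrt_nonneg (y - 1)
    have : √(1 + y) + √(y - 1) ≤ 2 * √y := by
      apply abs_le_of_sq_le_sq' _ (by positivity) |>.2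
      nlinarith [sq_nonneg (√(1 + y) - √(y - 1))]
    linarith

lemma kE_bound_small {r : ℝ} (h : |r| ≤ 1) : |kE r| ≤ 4 * |r| ^ (-1/2 : ℝ) := by
  rw [abs_of_nonpos (kE_nonpos r)]
  unfold kE
  rw [if_pos h]
  set y := |r| with hy
  have h0 : 0 ≤ y := abs_nonneg r
  rcases h0.eq_or_lt with h0 | h0
  · rw [← h0]; simp
  have hs : √y ^ 2 = y := Real.sq_sqrt h0.le
  have p2 : 0 < √y := Real.sqrt_pos.2 h0
  have : √(1 - y) ≤ √(1 + y) := Real.sqrt_le_sqrt (by linarith)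
  rw [rpow_n1 h0.le, show (2 / y : ℝ) = 2 / √y ^ 2 by rw [hs]]
  rw [← sub_nonneg]
  have : 4 * (1 / √y) - -(2 / √y ^ 2 * (√(1 + y) - 2 * √y + -√(1 - y)))
    = 2 / √y ^ 2 * (√(1 + y) - √(1 - y)) := by
    field_simp; ring
  rw [this]
  exact mul_nonneg (by positivity) (by linarith)

lemma kE_bound_large {r : ℝ} (h : 1 < |r|) : |kE r| ≤ 2 * |r| ^ (-3/2 : ℝ) := by
  rw [abs_of_nonpos (kE_nonpos r)]
  unfold kE
  rw [if_neg (not_le.2 h)]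
  set y := |r| with hy
  have h0 : 0 < y := by linarith
  have hs : √y ^ 2 = y := Real.sq_sqrt h0.le
  have p2 : 0 < √y := Real.sqrt_pos.2 h0
  have a2 : √(y - 1) ^ 2 = y - 1 := Real.sq_sqrt (by linarith)
  have p3 := Real.sqrt_nonneg (y - 1)
  have h1 : √y ≤ √(1 + y) := Real.sqrt_le_sqrt (by linarith)
  have h2 : √(y - 1) ≤ √y := Real.sqrt_le_sqrt (by linarith)
  have h3 : √y - √(y - 1) ≤ 1 / √y := by
    rw [le_div_iff₀ p2]; nlinarith
  rw [rpow_n3 h0]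
  calc -(2 / y * (√(1 + y) - 2 * √y + √(y - 1)))
      = 2 / y * ((√y - √(y - 1)) - (√(1 + y) - √y)) := by ring
    _ ≤ 2 / y * (1 / √y) := by gcongr; linarith
    _ = _ := by field_simp

lemma kE_meas : Measurable kE := by
  unfold kE
  apply Measurable.mul
  · fun_prop
  · apply Measurable.add
    · fun_prop
    · refine Measurable.ite (measurableSet_le (by fun_prop) (by fun_prop)) ?_ ?_ <;> fun_prop

lemma half_integrable (R : ℝ) : IntegrableOn (fun a : ℝ => |a| ^ (-1/2 : ℝ)) (Icc (-R) R) := by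
  have h := (intervalIntegral.intervalIntegrable_rpow' (a := 0) (b := R) (r := -1/2) (by norm_num))
  have h1 : IntervalIntegrable (fun a : ℝ => |a| ^ (-1/2 : ℝ)) volume 0 R := by
    rcases le_total 0 R with hR | hR
    · refine h.congr ?_
      intro a ha
      rw [uIoc_of_le hR] at ha
      simp only [abs_of_pos ha.1]
    · have h' := (intervalIntegral.intervalIntegrable_rpow' (a := 0) (b := -R) (r := -1/2) (by norm_num))
      have := h'.comp_sub_left 0
      simp only [sub_zero, sub_neg_eq_add, zero_add, zero_sub] at this
      refine this.congr ?_
      intro a ha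
      rw [uIoc_of_ge hR] at ha
      simp only [abs_of_nonpos ha.2]
  have h2 : IntervalIntegrable (fun a : ℝ => |a| ^ (-1/2 : ℝ)) volume (-R) 0 := by
    have := (h1.comp_sub_left 0)
    simpa using this.symm
  rcases le_total (-R) R with hR | hR
  · rw [← intervalIntegrable_iff_integrableOn_Icc_of_le hR]
    exact h2.trans h1
  · rcases hR.eq_or_lt with h | h
    · have : R = 0 := by linarith
      rw [this]; simp
    · rw [Icc_eq_empty (by linarith)]; simp

lemma kE_integrable : Integrable kE := by
  have h1 : IntegrableOn kE (Icc (-1) 1) := by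
    refine Integrable.mono' ((half_integrable 1).const_mul 4) kE_meas.aestronglyMeasurable ?_
    refine (ae_restrict_iff' measurableSet_Icc).2 (ae_of_all _ fun r hr => ?_)
    exact kE_bound_small (abs_le.2 hr)
  have h2 : IntegrableOn kE {a | 1 < |a|} := by
    have := (integral_abs_gt (F := fun a : ℝ => 2 * |a| ^ (-3/2 : ℝ)) one_pos
      ((int_three one_pos).1.const_mul 2)
      (by simp only [abs_neg]; exact (int_three one_pos).1.const_mul 2)).1
    refine Integrable.mono' this kE_meas.aestronglyMeasurable ?_
    refine (ae_restrict_iff' (measurableSet_lt measurable_const (by fun_prop))).2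
      (ae_of_all _ fun r hr => ?_)
    exact kE_bound_large hr
  rw [← integrableOn_univ]
  convert h1.union h2 using 1
  ext a
  simp only [mem_univ, mem_union, mem_Icc, mem_ofPred_eq, true_iff, ← abs_le]
  exact le_or_gt _ _

def cE : ℝ := ∫ r, kE r

lemma cE_neg : cE < 0 := by
  have h : 0 < ∫ r, - kE r := by
    rw [integral_pos_iff_support_of_nonneg (fun r => neg_nonneg.2 (kE_nonpos r))
      kE_integrable.neg]
    have : Ioo (2:ℝ) 3 ⊆ Function.support fun r => - kE r := by
      intro r hr
      have h0 : 0 < r := by linarith [hr.1]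
      simp only [Function.mem_support, ne_eq, neg_eq_zero]
      unfold kE
      rw [abs_of_pos h0, if_neg (by linarith [hr.1])]
      intro h
      rcases mul_eq_zero.1 h with h | h
      · have : 0 < 2 / r := by positivity
        linarith
      · have hs : √r ^ 2 = r := Real.sq_sqrt h0.le
        have a1 : √(1 + r) ^ 2 = 1 + r := Real.sq_sqrt (by linarith)
        have a2 : √(r - 1) ^ 2 = r - 1 := Real.sq_sqrt (by linarith [hr.1])
        have h1 : √(1 + r) + √(r - 1) = 2 * √r := by linarith
        have h2 : (√(1 + r) + √(r - 1)) ^ 2 = 4 * r := by rw [h1]; nlinarith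
        have h3 : (√(1 + r) - √(r - 1)) ^ 2 = 0 := by nlinarith
        have h4 : √(1 + r) = √(r - 1) := by
          have := pow_eq_zero_iff (two_ne_zero) |>.1 h3
          linarith
        rw [h4] at a1
        linarith
    refine lt_of_lt_of_le ?_ (measure_mono this)
    simp; norm_num
  rw [integral_neg] at h
  unfold cE
  linarith

lemma int_prod_of_bound {α β : Type*} [MeasurableSpace α] [MeasurableSpace β] {μ : Measure α}
    {m : Measure β} [SFinite m] [SFinite μ] {F : α × β → ℝ} (hF : Measurable F) (w : α → ℝ≥0∞)
    (h : ∀ a, ∫⁻ b, ‖F (a, b)‖ₑ ∂m ≤ w a) (hw : ∫⁻ a, w a ∂μ < ⊤) : Integrable F (μ.prod m) := by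
  refine ⟨hF.aestronglyMeasurable, ?_⟩
  unfold HasFiniteIntegral
  rw [lintegral_prod _ hF.enorm.aemeasurable]
  exact (lintegral_mono h).trans_lt hw

lemma half_lint (R : ℝ) (hR : 0 < R) :
    ∫⁻ a in Icc (-R) R, ENNReal.ofReal (|a| ^ (-1/2 : ℝ)) = ENNReal.ofReal (4 * √R) := by
  rw [← ofReal_integral_eq_lintegral_ofReal (half_integrable R)
    (ae_of_all _ fun a => by positivity)]
  congr 1
  rw [integral_Icc_eq_integral_Ioc, ← intervalIntegral.integral_of_le (by linarith)]
  have hi := half_integrable R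
  rw [← intervalIntegrable_iff_integrableOn_Icc_of_le (by linarith)] at hi
  have e1 : ∫ a in (0:ℝ)..R, |a| ^ (-1/2 : ℝ) = 2 * √R := by
    have : ∫ a in (0:ℝ)..R, |a| ^ (-1/2 : ℝ) = ∫ a in (0:ℝ)..R, a ^ (-1/2 : ℝ) := by
      apply intervalIntegral.integral_congr
      intro a ha
      rw [uIcc_of_le hR.le] at ha
      simp only [abs_of_nonneg ha.1]
    rw [this, integral_rpow (Or.inl (by norm_num))]
    rw [show (-1/2 + 1 : ℝ) = 1/2 by norm_num, Real.zero_rpow (by norm_num), ← Real.sqrt_eq_rpow]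
    ring
  have e2 : ∫ a in (-R)..0, |a| ^ (-1/2 : ℝ) = 2 * √R := by
    rw [← e1]
    have := intervalIntegral.integral_comp_neg (a := 0) (b := R) (fun a : ℝ => |a| ^ (-1/2 : ℝ))
    simp only [abs_neg, neg_zero] at this
    rw [this]
  rw [← intervalIntegral.integral_add_adjacent_intervals (b := 0), e1, e2]
  · ring
  · apply hi.mono_set; rw [uIcc_of_le (by linarith), uIcc_of_le (by linarith)]
    exact Icc_subset_Icc le_rfl hR.le
  · apply hi.mono_set; rw [uIcc_of_le (by linarith), uIcc_of_le (by linarith)]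
    exact Icc_subset_Icc (by linarith) le_rfl

lemma half_conv (b : ℝ → ℝ≥0∞) (hbm : Measurable b) (B : ℝ≥0∞) (hb : ∀ t, b t ≤ B) {R : ℝ}
    (hR : 0 < R) (u : ℝ) :
    ∫⁻ t, ENNReal.ofReal (|t - u| ^ (-1/2 : ℝ)) * b t ≤
      ENNReal.ofReal (4 * √R) * B + ENNReal.ofReal (R ^ (-1/2 : ℝ)) * ∫⁻ t, b t := by
  have hm : Measurable fun a : ℝ => (Icc (-R) R).indicator
      (fun a : ℝ => ENNReal.ofReal (|a| ^ (-1/2 : ℝ))) a :=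
    Measurable.indicator (by fun_prop) measurableSet_Icc
  calc ∫⁻ t, ENNReal.ofReal (|t - u| ^ (-1/2 : ℝ)) * b t
      ≤ ∫⁻ t, ((Icc (-R) R).indicator (fun a : ℝ => ENNReal.ofReal (|a| ^ (-1/2 : ℝ))) (t - u) * B
        + ENNReal.ofReal (R ^ (-1/2 : ℝ)) * b t) := by
        apply lintegral_mono
        intro t
        by_cases h : t - u ∈ Icc (-R) R
        · simp only [indicator_of_mem h]
          exact le_add_right (mul_le_mul' le_rfl (hb t))
        · simp only [indicator_of_notMem h, zero_mul, zero_add]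
          refine mul_le_mul' (ENNReal.ofReal_le_ofReal ?_) le_rfl
          apply Real.rpow_le_rpow_of_nonpos hR _ (by norm_num)
          by_contra h'
          push Not at h'
          exact h (abs_le.1 h'.le)
    _ = _ := by
        rw [lintegral_add_left (by fun_prop), lintegral_mul_const _ (by fun_prop),
          lintegral_const_mul _ hbm]
        congr 2
        rw [lintegral_sub_right_eq_self (fun a => (Icc (-R) R).indicator
          (fun a : ℝ => ENNReal.ofReal (|a| ^ (-1/2 : ℝ))) a) u,
          lintegral_indicator measurableSet_Icc, half_lint R hR]

/-- half potential -/
def pot (h : ℝ → ℝ) (t : ℝ) : ℝ := ∫ s, |t - s| ^ (-1/2 : ℝ) * h s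

structure Nice (h : ℝ → ℝ) (B T L : ℝ) : Prop where
  meas : Measurable h
  bdd : ∀ s, |h s| ≤ B
  supp : ∀ s, s ∉ Icc T (T + L) → h s = 0
  Lpos : 0 < L
  Bpos : 0 ≤ B

lemma Nice.lint {h : ℝ → ℝ} {B T L : ℝ} (H : Nice h B T L) :
    ∫⁻ s, ‖h s‖ₑ ≤ ENNReal.ofReal (B * L) := by
  calc ∫⁻ s, ‖h s‖ₑ ≤ ∫⁻ s, (Icc T (T + L)).indicator (fun _ => ENNReal.ofReal B) s := by
        apply lintegral_mono
        intro s
        by_cases hs : s ∈ Icc T (T + L)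
        · simp only [indicator_of_mem hs]
          rw [← ofReal_norm]
          exact ENNReal.ofReal_le_ofReal (H.bdd s)
        · simp [indicator_of_notMem hs, H.supp s hs]
    _ = _ := by
        rw [lintegral_indicator measurableSet_Icc, setLIntegral_const, Real.volume_Icc,
          ← ENNReal.ofReal_mul H.Bpos]
        congr 2; ring

lemma Nice.integrable {h : ℝ → ℝ} {B T L : ℝ} (H : Nice h B T L) : Integrable h :=
  ⟨H.meas.aestronglyMeasurable, H.lint.trans_lt ENNReal.ofReal_lt_top⟩

lemma Nice.pot_lint {h : ℝ → ℝ} {B T L : ℝ} (H : Nice h B T L) (t : ℝ) :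
    ∫⁻ s, ‖|t - s| ^ (-1/2 : ℝ) * h s‖ₑ ≤ ENNReal.ofReal (5 * B * √L) := by
  have h1 := half_conv (fun s => ‖h s‖ₑ) H.meas.enorm (ENNReal.ofReal B)
    (fun s => by rw [← ofReal_norm]; exact ENNReal.ofReal_le_ofReal (H.bdd s)) H.Lpos t
  have e : ∀ s, ‖|t - s| ^ (-1/2 : ℝ) * h s‖ₑ = ENNReal.ofReal (|s - t| ^ (-1/2 : ℝ)) * ‖h s‖ₑ := by
    intro s
    rw [enorm_mul, abs_sub_comm, Real.enorm_of_nonneg (by positivity)]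
  simp_rw [e]
  refine h1.trans ?_
  have hB := H.Bpos
  have hL := H.Lpos
  calc _ ≤ ENNReal.ofReal (4 * √L) * ENNReal.ofReal B
      + ENNReal.ofReal (L ^ (-1/2 : ℝ)) * ENNReal.ofReal (B * L) := by gcongr; exact H.lint
    _ = ENNReal.ofReal (5 * B * √L) := by
      rw [← ENNReal.ofReal_mul (by positivity), ← ENNReal.ofReal_mul (by positivity),
        ← ENNReal.ofReal_add (by positivity) (by positivity)]
      congr 1
      rw [rpow_n1 hL.le]
      have : √L ^ 2 = L := Real.sq_sqrt hL.le
      have h0 : 0 < √L := Real.sqrt_pos.2 hL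
      rw [show B * L = B * √L ^ 2 by rw [this]]
      field_simp
      norm_num

lemma Nice.pot_integrable {h : ℝ → ℝ} {B T L : ℝ} (H : Nice h B T L) (t : ℝ) :
    Integrable fun s => |t - s| ^ (-1/2 : ℝ) * h s :=
  ⟨by have := H.meas; exact (by fun_prop : Measurable _).aestronglyMeasurable,
    (H.pot_lint t).trans_lt ENNReal.ofReal_lt_top⟩

lemma Nice.pot_bound {h : ℝ → ℝ} {B T L : ℝ} (H : Nice h B T L) (t : ℝ) :
    |pot h t| ≤ 5 * B * √L := by
  have hB := H.Bpos
  have h1 : ‖pot h t‖ₑ ≤ ENNReal.ofReal (5 * B * √L) :=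
    (enorm_integral_le_lintegral_enorm _).trans (H.pot_lint t)
  rw [← ofReal_norm, ENNReal.ofReal_le_ofReal_iff (by positivity)] at h1
  exact h1

lemma sq_diff {p q L : ℝ} (hq : 0 < q) (hp : q / 2 ≤ p) (hpq : |p - q| ≤ L) :
    |p ^ (-1/2 : ℝ) - q ^ (-1/2 : ℝ)| ≤ 2 * L * q ^ (-3/2 : ℝ) := by
  have hp0 : 0 < p := by linarith
  rw [rpow_n1 hp0.le, rpow_n1 hq.le, rpow_n3 hq]
  have hL : 0 ≤ L := (abs_nonneg _).trans hpq
  set x := √p with hx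
  set y := √q with hy
  have hx0 : 0 < x := Real.sqrt_pos.2 hp0
  have hy0 : 0 < y := Real.sqrt_pos.2 hq
  have hxx : x ^ 2 = p := Real.sq_sqrt hp0.le
  have hyy : y ^ 2 = q := Real.sq_sqrt hq.le
  have e : 1 / x - 1 / y = -(p - q) / (x * y * (x + y)) := by
    rw [← hxx, ← hyy]; field_simp; ring
  rw [e, abs_div, abs_neg, abs_of_pos (by positivity : 0 < x * y * (x + y))]
  rw [div_le_iff₀ (by positivity)]
  refine hpq.trans ?_
  rw [← hyy]
  have : 2 * L * (1 / (y ^ 2 * y)) * (x * y * (x + y)) = L * ((2 * x ^ 2 + 2 * x * y) / y ^ 2) := by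
    field_simp
  rw [this]
  have h1 : 1 ≤ (2 * x ^ 2 + 2 * x * y) / y ^ 2 := by
    rw [le_div_iff₀ (by positivity)]
    nlinarith [mul_pos hx0 hy0]
  nlinarith

lemma Nice.pot_far {h : ℝ → ℝ} {B T L : ℝ} (H : Nice h B T L) (h0 : ∫ s, h s = 0) (t : ℝ)
    (ht : t ∉ Icc (T - L) (T + 3 * L)) : |pot h t| ≤ 2 * B * L ^ 2 * |t - T| ^ (-3/2 : ℝ) := by
  have hB := H.Bpos
  have hL := H.Lpos
  have e : pot h t = ∫ s, (|t - s| ^ (-1/2 : ℝ) - |t - T| ^ (-1/2 : ℝ)) * h s := by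
    simp_rw [sub_mul]
    rw [integral_sub (H.pot_integrable t) (H.integrable.const_mul _), integral_const_mul, h0]
    simp [pot]
  have h1 : ‖pot h t‖ₑ ≤ ENNReal.ofReal (2 * L * |t - T| ^ (-3/2 : ℝ)) * ENNReal.ofReal (B * L) := by
    rw [e]
    refine (enorm_integral_le_lintegral_enorm _).trans ?_
    calc _ ≤ ∫⁻ s, ENNReal.ofReal (2 * L * |t - T| ^ (-3/2 : ℝ)) * ‖h s‖ₑ := by
          apply lintegral_mono
          intro s
          by_cases hs : s ∈ Icc T (T + L)
          · beta_reduce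
            rw [enorm_mul]
            gcongr
            rw [← ofReal_norm]
            apply ENNReal.ofReal_le_ofReal
            rw [mem_Icc, not_and_or, not_le, not_le] at ht
            obtain ⟨s1, s2⟩ := hs
            apply sq_diff
            · rcases ht with ht | ht
              · rw [abs_of_neg (by linarith)]; linarith
              · rw [abs_of_pos (by linarith)]; linarith
            · rcases ht with ht | ht
              · rw [abs_of_neg (by linarith), abs_of_neg (by linarith)]; linarith
              · rw [abs_of_pos (by linarith), abs_of_pos (by linarith)]; linarith
            · refine (abs_abs_sub_abs_le _ _).trans ?_
              rw [abs_le]; constructor <;> linarith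
          · simp [H.supp s hs]
      _ ≤ _ := by
          rw [lintegral_const_mul _ H.meas.enorm]
          gcongr
          exact H.lint
  rw [← ENNReal.ofReal_mul (by positivity), ← ofReal_norm,
    ENNReal.ofReal_le_ofReal_iff (by positivity)] at h1
  refine h1.trans (le_of_eq ?_)
  ring

/-- majorant -/
def bnd (B T L t : ℝ) : ℝ := by
  classical exact if t ∈ Icc (T - L) (T + 3 * L) then 5 * B * √L
    else 2 * B * L ^ 2 * |t - T| ^ (-3/2 : ℝ)

lemma Nice.le_bnd {h : ℝ → ℝ} {B T L : ℝ} (H : Nice h B T L) (h0 : ∫ s, h s = 0) (t : ℝ) :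
    |pot h t| ≤ bnd B T L t := by
  unfold bnd
  split_ifs with ht
  · exact H.pot_bound t
  · exact H.pot_far h0 t ht

lemma bnd_nonneg {B T L : ℝ} (hB : 0 ≤ B) (t : ℝ) : 0 ≤ bnd B T L t := by
  unfold bnd; split_ifs <;> positivity

lemma bnd_far {T L t : ℝ} (hL : 0 < L) (ht : t ∉ Icc (T - L) (T + 3 * L)) : L < |t - T| := by
  rw [mem_Icc, not_and_or, not_le, not_le] at ht
  rw [lt_abs]
  rcases ht with ht | ht
  · right; linarith
  · left; linarith

lemma bnd_le {B T L : ℝ} (hB : 0 ≤ B) (hL : 0 < L) (t : ℝ) : bnd B T L t ≤ 5 * B * √L := by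
  unfold bnd; split_ifs with ht
  · exact le_rfl
  · have h1 := bnd_far hL ht
    have h2 : |t - T| ^ (-3/2 : ℝ) ≤ L ^ (-3/2 : ℝ) :=
      Real.rpow_le_rpow_of_nonpos hL h1.le (by norm_num)
    calc _ ≤ 2 * B * L ^ 2 * L ^ (-3/2 : ℝ) := by gcongr
      _ = 2 * B * √L := by
        rw [rpow_n3 hL]
        have : √L ^ 2 = L := Real.sq_sqrt hL.le
        have h0 : 0 < √L := Real.sqrt_pos.2 hL
        field_simp
        rw [this]
      _ ≤ _ := by gcongr; norm_num

lemma bnd_meas (B T L : ℝ) : Measurable (bnd B T L) := by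
  unfold bnd
  exact Measurable.ite measurableSet_Icc (by fun_prop) (by fun_prop)

lemma three_integrable {ε : ℝ} (hε : 0 < ε) :
    IntegrableOn (fun a : ℝ => |a| ^ (-3/2 : ℝ)) {a : ℝ | ε < |a|} :=
  (integral_abs_gt (F := fun a : ℝ => |a| ^ (-3/2 : ℝ)) hε (int_three hε).1
      (by simp only [abs_neg]; exact (int_three hε).1)).1

lemma meas_abs_gt (ε : ℝ) : MeasurableSet {a : ℝ | ε < |a|} :=
  measurableSet_lt measurable_const (by fun_prop)

lemma bnd_integrable {B T L : ℝ} (hB : 0 ≤ B) (hL : 0 < L) : Integrable (bnd B T L) := by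
  have h1 : Integrable ((Icc (T - L) (T + 3 * L)).indicator fun _ => 5 * B * √L) :=
    (integrable_indicator_iff measurableSet_Icc).2 (integrableOn_const (by simp))
  have h2 : Integrable (fun t => ({a : ℝ | L < |a|}).indicator
      (fun a => |a| ^ (-3/2 : ℝ)) (t - T)) :=
    ((integrable_indicator_iff (meas_abs_gt L)).2 (three_integrable hL)).comp_sub_right T
  refine (h1.add (h2.const_mul (2 * B * L ^ 2))).mono' (bnd_meas B T L).aestronglyMeasurable
    (ae_of_all _ fun t => ?_)
  rw [Real.norm_of_nonneg (bnd_nonneg hB t), Pi.add_apply]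
  by_cases ht : t ∈ Icc (T - L) (T + 3 * L)
  · rw [indicator_of_mem ht]
    unfold bnd
    rw [if_pos ht]
    have : 0 ≤ ({a : ℝ | L < |a|}).indicator (fun a => |a| ^ (-3/2 : ℝ)) (t - T) :=
      indicator_nonneg (fun a _ => by positivity) _
    have : 0 ≤ 2 * B * L ^ 2 * ({a : ℝ | L < |a|}).indicator (fun a => |a| ^ (-3/2 : ℝ)) (t - T) := by
      positivity
    linarith
  · rw [indicator_of_notMem ht]
    unfold bnd
    rw [if_neg ht, indicator_of_mem (show t - T ∈ {a : ℝ | L < |a|} from bnd_far hL ht)]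
    simp

lemma Nice.pot_diff {h : ℝ → ℝ} {B T L : ℝ} (H : Nice h B T L) {ε : ℝ} (hε : 0 < ε) (t : ℝ) :
    ∫ a in {a : ℝ | ε < |a|}, |a| ^ (-3/2 : ℝ) * (pot h (t + a) - pot h t)
      = ∫ r, h (t + ε * r) * kE r := by
  have hm := H.meas
  have fin : ∫⁻ a in {a : ℝ | ε < |a|}, ‖|a| ^ (-3/2 : ℝ)‖ₑ * ENNReal.ofReal (5 * B * √L) < ⊤ := by
    rw [lintegral_mul_const _ (by fun_prop)]
    exact ENNReal.mul_lt_top (three_integrable hε).2 ENNReal.ofReal_lt_top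
  have I1 : Integrable (fun z : ℝ × ℝ => |z.1| ^ (-3/2 : ℝ) * (|t + z.1 - z.2| ^ (-1/2 : ℝ) * h z.2))
      ((volume.restrict {a : ℝ | ε < |a|}).prod volume) := by
    refine int_prod_of_bound (by fun_prop) _ (fun a => ?_) fin
    simp only [enorm_mul (|a| ^ (-3/2 : ℝ))]
    rw [lintegral_const_mul _ (by fun_prop)]
    gcongr
    exact H.pot_lint (t + a)
  have I2 : Integrable (fun z : ℝ × ℝ => |z.1| ^ (-3/2 : ℝ) * (|t - z.2| ^ (-1/2 : ℝ) * h z.2))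
      ((volume.restrict {a : ℝ | ε < |a|}).prod volume) := by
    refine int_prod_of_bound (by fun_prop) _ (fun a => ?_) fin
    simp only [enorm_mul (|a| ^ (-3/2 : ℝ))]
    rw [lintegral_const_mul _ (by fun_prop)]
    gcongr
    exact H.pot_lint t
  have I3 := I1.sub I2
  have e1 : ∀ a : ℝ, |a| ^ (-3/2 : ℝ) * (pot h (t + a) - pot h t) =
      ∫ s, (|a| ^ (-3/2 : ℝ) * (|t + a - s| ^ (-1/2 : ℝ) * h s)
        - |a| ^ (-3/2 : ℝ) * (|t - s| ^ (-1/2 : ℝ) * h s)) := by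
    intro a
    rw [integral_sub ((H.pot_integrable _).const_mul _) ((H.pot_integrable _).const_mul _),
      integral_const_mul, integral_const_mul, ← mul_sub]
    rfl
  simp_rw [e1]
  rw [integral_integral_swap (f := fun a s => (|a| ^ (-3/2 : ℝ) * (|t + a - s| ^ (-1/2 : ℝ) * h s)
        - |a| ^ (-3/2 : ℝ) * (|t - s| ^ (-1/2 : ℝ) * h s))) I3]
  have e2 : ∀ᵐ s : ℝ, ∫ a in {a : ℝ | ε < |a|}, (|a| ^ (-3/2 : ℝ) * (|t + a - s| ^ (-1/2 : ℝ) * h s)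
        - |a| ^ (-3/2 : ℝ) * (|t - s| ^ (-1/2 : ℝ) * h s)) = h s * (ε⁻¹ * kE ((s - t) / ε)) := by
    have : ∀ᵐ s : ℝ, s ≠ t := by simp [ae_iff]
    filter_upwards [this] with s hs
    rw [← kE_eq (sub_ne_zero.2 hs) hε, ← integral_const_mul]
    congr 1
    funext a
    rw [show t + a - s = a - (s - t) by ring, abs_sub_comm t s]
    ring
  rw [integral_congr_ae e2]
  have e3 := Measure.integral_comp_mul_left (fun r => h (t + r) * (ε⁻¹ * kE (r / ε))) ε
  have e4 := integral_add_left_eq_self (μ := volume) (fun s => h s * (ε⁻¹ * kE ((s - t) / ε))) t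
  simp only [add_sub_cancel_left] at e4
  rw [← e4]
  have : ∀ r, h (t + ε * r) * (ε⁻¹ * kE (ε * r / ε)) = ε⁻¹ * (h (t + ε * r) * kE r) := by
    intro r
    rw [mul_div_cancel_left₀ _ hε.ne']; ring
  simp_rw [this] at e3
  rw [integral_const_mul, smul_eq_mul, abs_of_pos (inv_pos.2 hε)] at e3
  exact (mul_left_cancel₀ (inv_pos.2 hε).ne' e3).symm

lemma pot_eq_conv (g : ℝ → ℝ) : pot g =
    convolution (fun a : ℝ => |a| ^ (-1/2 : ℝ)) g (ContinuousLinearMap.mul ℝ ℝ) volume := by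
  funext t
  simp only [convolution, ContinuousLinearMap.mul_apply', pot]
  rw [← integral_sub_left_eq_self _ volume t]
  simp

lemma half_locint : LocallyIntegrable (fun a : ℝ => |a| ^ (-1/2 : ℝ)) := by
  intro x
  refine ⟨Icc (-(|x| + 1)) (|x| + 1), ?_, half_integrable _⟩
  apply Icc_mem_nhds
  · linarith [neg_abs_le x]
  · linarith [le_abs_self x]

lemma pot_tendsto {g : ℝ → ℝ} {B T L : ℝ} (H : Nice g B T L) {l : Filter ℝ}
    [l.IsCountablyGenerated] (hl : Tendsto (fun t : ℝ => |t|) l atTop) :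
    Tendsto (pot g) l (𝓝 0) := by
  have : Tendsto (pot g) l (𝓝 (∫ _ : ℝ, (0:ℝ))) := by
    apply tendsto_integral_filter_of_dominated_convergence (fun s => |g s|)
    · have := H.meas
      exact Eventually.of_forall fun t => (by fun_prop : Measurable _).aestronglyMeasurable
    · filter_upwards [hl.eventually_ge_atTop (|T| + L + 1)] with t ht
      refine ae_of_all _ fun s => ?_
      by_cases hs : s ∈ Icc T (T + L)
      · rw [norm_mul, Real.norm_eq_abs, Real.norm_eq_abs]
        apply mul_le_of_le_one_left (abs_nonneg _)
        rw [abs_of_nonneg (by positivity)]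
        apply Real.rpow_le_one_of_one_le_of_nonpos _ (by norm_num)
        have h1 : |s| ≤ |T| + L := by
          have h2 : |s - T| ≤ L := by rw [abs_le]; constructor <;> linarith [hs.1, hs.2, H.Lpos]
          have := abs_add_le T (s - T)
          rw [add_sub_cancel] at this
          linarith
        have := abs_sub_abs_le_abs_sub t s
        linarith
      · simp [H.supp s hs]
    · exact H.integrable.abs
    · refine ae_of_all _ fun s => ?_
      have h1 : Tendsto (fun t : ℝ => |t - s|) l atTop := by
        refine tendsto_atTop_mono (fun t => abs_sub_abs_le_abs_sub t s) ?_
        exact tendsto_atTop_add_const_right _ _ hl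
      have h2 := (tendsto_rpow_neg_atTop (y := 1/2) (by norm_num)).comp h1
      have := h2.mul_const (g s)
      simpa [Function.comp_def, neg_div] using this
  simpa using this

lemma pot_mean_zero {g : ℝ → ℝ} {B B' T L : ℝ} (hg : ContDiff ℝ 1 g) (H : Nice g B T L)
    (H' : Nice (deriv g) B' T L) :
    ∫ t, pot (deriv g) t = 0 := by
  have hc : HasCompactSupport g := HasCompactSupport.intro isCompact_Icc H.supp
  have hi : ∫ t, deriv g t = 0 := by
    exact integral_eq_zero_of_hasDerivAt_of_integrable
      (fun x => (hg.differentiable one_ne_zero x).hasDerivAt) H'.integrable H.integrable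
  have hd : ∀ t, HasDerivAt (pot g) (pot (deriv g) t) t := by
    intro t
    rw [pot_eq_conv, pot_eq_conv]
    exact hc.hasDerivAt_convolution_right _ half_locint hg t
  have hpm : Measurable (pot (deriv g)) := by
    have : pot (deriv g) = deriv (pot g) := by funext t; exact (hd t).deriv.symm
    rw [this]
    exact measurable_deriv _
  have hpi : Integrable (pot (deriv g)) := by
    refine (bnd_integrable (T := T) H'.Bpos H'.Lpos).mono' hpm.aestronglyMeasurable ?_
    exact ae_of_all _ fun t => H'.le_bnd hi t
  have := integral_of_hasDerivAt_of_tendsto hd hpi (pot_tendsto H tendsto_abs_atBot_atTop)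
    (pot_tendsto H tendsto_abs_atTop_atTop)
  simpa using this

section abstractId
variable {X : Type*} [MeasurableSpace X]

lemma swap23 (m : Measure X) [SFinite m] :
    MeasurePreserving (fun z : (X × ℝ) × ℝ => ((z.1.1, z.2), z.1.2))
      ((m.prod volume).prod volume) ((m.prod volume).prod volume) := by
  have h1 := measurePreserving_prodAssoc m (volume : Measure ℝ) (volume : Measure ℝ)
  have h2 : MeasurePreserving (Prod.map id Prod.swap : X × (ℝ × ℝ) → X × (ℝ × ℝ))
      (m.prod (volume.prod volume)) (m.prod (volume.prod volume)) :=
    (MeasurePreserving.id m).prod Measure.measurePreserving_swap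
  exact (h1.symm).comp (h2.comp h1)

lemma fw_lint (m : Measure X) [SFinite m] {f : X × ℝ → ℝ} (hf : Measurable f) {M : ℝ≥0∞}
    (hfM : ∀ t, ∫⁻ x, ‖f (x, t)‖ₑ ∂m ≤ M) {w : ℝ → ℝ≥0∞} (hw : Measurable w) :
    ∫⁻ p, ‖f p‖ₑ * w p.2 ∂(m.prod volume) ≤ M * ∫⁻ t, w t := by
  rw [lintegral_prod_symm' _ (by fun_prop), ← lintegral_const_mul _ hw]
  apply lintegral_mono
  intro t
  show ∫⁻ x, ‖f (x, t)‖ₑ * w t ∂m ≤ M * w t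
  rw [lintegral_mul_const _ (by fun_prop)]
  gcongr
  exact hfM t

lemma pot_joint_meas {h : X × ℝ → ℝ} (hh : Measurable h) :
    Measurable fun p : X × ℝ => pot (fun s => h (p.1, s)) p.2 := by
  have : StronglyMeasurable (fun z : (X × ℝ) × ℝ => |z.1.2 - z.2| ^ (-1/2 : ℝ) * h (z.1.1, z.2)) := by
    apply Measurable.stronglyMeasurable
    fun_prop
  exact this.integral_prod_right'.measurable

/-- shifted pairing -/
def Psi (m : Measure X) (f h : X × ℝ → ℝ) (δ : ℝ) : ℝ := ∫ p, f p * h (p.1, p.2 + δ) ∂(m.prod volume)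

lemma shift_lint (m : Measure X) [SFinite m] {f : X × ℝ → ℝ} (hf : Measurable f) {M : ℝ≥0∞}
    (hfM : ∀ t, ∫⁻ x, ‖f (x, t)‖ₑ ∂m ≤ M) {h : X × ℝ → ℝ}
    {B T L : ℝ} (hN : ∀ x, Nice (fun s => h (x, s)) B T L) (δ : ℝ) :
    ∫⁻ p, ‖f p * h (p.1, p.2 + δ)‖ₑ ∂(m.prod volume)
      ≤ M * (ENNReal.ofReal B * ENNReal.ofReal L) := by
  calc _ ≤ ∫⁻ p : X × ℝ, ‖f p‖ₑ * ((fun t : ℝ =>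
        (Icc T (T + L)).indicator (fun _ => ENNReal.ofReal B) (t + δ)) p.2) ∂(m.prod volume) := by
        apply lintegral_mono
        intro p
        beta_reduce
        rw [enorm_mul]
        gcongr
        by_cases hs : p.2 + δ ∈ Icc T (T + L)
        · rw [indicator_of_mem hs, ← ofReal_norm]
          exact ENNReal.ofReal_le_ofReal ((hN p.1).bdd _)
        · rw [(hN p.1).supp _ hs]; simp
    _ ≤ M * ∫⁻ t, (Icc T (T + L)).indicator (fun _ => ENNReal.ofReal B) (t + δ) := by
        apply fw_lint m hf hfM
        exact (measurable_const.indicator measurableSet_Icc).comp (measurable_add_const δ)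
    _ = _ := by
        rw [lintegral_add_right_eq_self (fun t => (Icc T (T + L)).indicator
          (fun _ => ENNReal.ofReal B) t) δ, lintegral_indicator measurableSet_Icc,
          setLIntegral_const, Real.volume_Icc, add_sub_cancel_left]

lemma Psi_tendsto (m : Measure X) [SFinite m] {f : X × ℝ → ℝ} (hf : Measurable f) {M : ℝ≥0∞}
    (hM : M ≠ ⊤) (hfM : ∀ t, ∫⁻ x, ‖f (x, t)‖ₑ ∂m ≤ M) {h : X × ℝ → ℝ} (hh : Measurable h)
    {B T L : ℝ} (hN : ∀ x, Nice (fun s => h (x, s)) B T L)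
    (hc : ∀ x, Continuous fun s => h (x, s)) :
    Tendsto (Psi m f h) (𝓝 0) (𝓝 (Psi m f h 0)) := by
  unfold Psi
  apply tendsto_integral_filter_of_dominated_convergence
    (fun p : X × ℝ => ‖f p‖ * (Icc (T - 1) (T + L + 1)).indicator (fun _ => B) p.2)
  · exact Eventually.of_forall fun t => (by fun_prop : Measurable _).aestronglyMeasurable
  · filter_upwards [Metric.ball_mem_nhds (0:ℝ) one_pos] with δ hδ
    refine ae_of_all _ fun p => ?_
    rw [norm_mul]
    gcongr
    rw [Metric.mem_ball, dist_zero_right, Real.norm_eq_abs, abs_lt] at hδ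
    by_cases hs : p.2 ∈ Icc (T - 1) (T + L + 1)
    · rw [indicator_of_mem hs]; exact (hN p.1).bdd _
    · rw [indicator_of_notMem hs]
      have := (hN p.1).supp (p.2 + δ) (by
        intro h'
        apply hs
        constructor <;> linarith [h'.1, h'.2])
      rw [this]; simp
  · refine ⟨?_, ?_⟩
    · apply Measurable.aestronglyMeasurable
      apply Measurable.mul (by fun_prop)
      exact (measurable_const.indicator measurableSet_Icc).comp measurable_snd
    · unfold HasFiniteIntegral
      have e : ∀ p : X × ℝ, ‖‖f p‖ * (Icc (T - 1) (T + L + 1)).indicator (fun _ => B) p.2‖ₑ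
        = ‖f p‖ₑ * (fun t => ‖(Icc (T - 1) (T + L + 1)).indicator (fun _ => B) t‖ₑ) p.2 := by
        intro p; rw [enorm_mul, enorm_norm]
      simp_rw [e]
      have hm : Measurable (fun t : ℝ => ‖(Icc (T - 1) (T + L + 1)).indicator (fun _ => B) t‖ₑ) :=
        (measurable_const.indicator measurableSet_Icc).enorm
      refine (fw_lint m hf hfM hm).trans_lt ?_
      apply ENNReal.mul_lt_top hM.lt_top
      have : IntegrableOn (fun _ : ℝ => B) (Icc (T - 1) (T + L + 1)) := integrableOn_const (by simp)
      exact ((integrable_indicator_iff measurableSet_Icc).2 this).2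
  · refine ae_of_all _ fun p => ?_
    have h1 : Continuous fun δ => f p * h (p.1, p.2 + δ) := by
      have := hc p.1
      exact continuous_const.mul (this.comp (continuous_const.add continuous_id))
    exact h1.tendsto 0

lemma kap_lint {ε : ℝ} (hε : 0 < ε) :
    ∫⁻ a, ‖({a : ℝ | ε < |a|}).indicator (fun a => |a| ^ (-3/2 : ℝ)) a‖ₑ < ⊤ :=
  ((integrable_indicator_iff (meas_abs_gt ε)).2 (three_integrable hε)).2

/-- the truncated identity -/
lemma trunc_identity (m : Measure X) [SFinite m] {f : X × ℝ → ℝ} (hf : Measurable f) {M : ℝ≥0∞}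
    (hM : M ≠ ⊤) (hfM : ∀ t, ∫⁻ x, ‖f (x, t)‖ₑ ∂m ≤ M) {h : X × ℝ → ℝ} (hh : Measurable h)
    {B T L : ℝ} (hN : ∀ x, Nice (fun s => h (x, s)) B T L) (hB : 0 ≤ B) (hL : 0 < L)
    (h0 : ∀ x, ∫ s, h (x, s) = 0) {ε : ℝ} (hε : 0 < ε) :
    ∫ z, (f (z.1.1, z.2) - f z.1) *
      (({a : ℝ | ε < |a|}).indicator (fun a => |a| ^ (-3/2 : ℝ)) (z.2 - z.1.2)
        * pot (fun s => h (z.1.1, s)) z.1.2) ∂((m.prod volume).prod volume)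
      = ∫ r, kE r * Psi m f h (ε * r) := by
  set κ : ℝ → ℝ := ({a : ℝ | ε < |a|}).indicator (fun a => |a| ^ (-3/2 : ℝ)) with hκ
  set ψ : X × ℝ → ℝ := fun p => pot (fun s => h (p.1, s)) p.2 with hψ
  have hψm : Measurable ψ := pot_joint_meas hh
  have hκm : Measurable κ := (by fun_prop : Measurable fun a : ℝ => |a| ^ (-3/2 : ℝ)).indicator
    (meas_abs_gt ε)
  have hκe : ∀ a, κ (-a) = κ a := by
    intro a; simp only [hκ, indicator, mem_ofPred_eq, abs_neg]
  have hψb : ∀ p, ‖ψ p‖ₑ ≤ ENNReal.ofReal (bnd B T L p.2) := by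
    intro p
    rw [← ofReal_norm]
    exact ENNReal.ofReal_le_ofReal ((hN p.1).le_bnd (h0 p.1) p.2)
  have hbm := bnd_meas B T L
  have hbi : ∫⁻ t, ENNReal.ofReal (bnd B T L t) < ⊤ := by
    have := (bnd_integrable (T := T) hB hL).2
    unfold HasFiniteIntegral at this
    refine lt_of_eq_of_lt ?_ this
    apply lintegral_congr
    intro t
    rw [Real.enorm_of_nonneg (bnd_nonneg hB t)]
  have hκi : ∫⁻ a, ‖κ a‖ₑ < ⊤ := kap_lint hε
  have IA : Integrable (fun z : (X × ℝ) × ℝ => f z.1 * (κ (z.2 - z.1.2) * ψ (z.1.1, z.2)))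
      ((m.prod volume).prod volume) := by
    refine int_prod_of_bound (by fun_prop) (fun p => ‖f p‖ₑ * (fun t =>
      ∫⁻ s, ‖κ (s - t)‖ₑ * ENNReal.ofReal (bnd B T L s)) p.2) (fun p => ?_) ?_
    · simp only [enorm_mul]
      rw [lintegral_const_mul _ (by fun_prop)]
      gcongr with s
      exact hψb _
    · have hwm : Measurable (fun t : ℝ => ∫⁻ s, ‖κ (s - t)‖ₑ * ENNReal.ofReal (bnd B T L s)) := by
        apply Measurable.lintegral_prod_right (f := fun t s => ‖κ (s - t)‖ₑ * ENNReal.ofReal (bnd B T L s))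
        fun_prop
      refine (fw_lint m hf hfM hwm).trans_lt ?_
      apply ENNReal.mul_lt_top hM.lt_top
      rw [lintegral_lintegral_swap (by fun_prop)]
      have : ∀ s : ℝ, ∫⁻ t, ‖κ (s - t)‖ₑ * ENNReal.ofReal (bnd B T L s)
          = (∫⁻ a, ‖κ a‖ₑ) * ENNReal.ofReal (bnd B T L s) := by
        intro s
        rw [lintegral_mul_const _ (by fun_prop),
          lintegral_sub_left_eq_self (fun a => ‖κ a‖ₑ) s]
      simp_rw [this]
      rw [lintegral_const_mul _ (by fun_prop)]
      exact ENNReal.mul_lt_top hκi hbi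
  have IA2 : Integrable (fun z : (X × ℝ) × ℝ => f z.1 * (κ (z.2 - z.1.2) * ψ z.1))
      ((m.prod volume).prod volume) := by
    refine int_prod_of_bound (by fun_prop) (fun p => ‖f p‖ₑ * (fun t =>
      (∫⁻ a, ‖κ a‖ₑ) * ENNReal.ofReal (bnd B T L t)) p.2) (fun p => ?_) ?_
    · simp only [enorm_mul]
      rw [lintegral_const_mul _ (by fun_prop), lintegral_mul_const _ (by fun_prop),
          lintegral_sub_right_eq_self (fun a => ‖κ a‖ₑ)]
      gcongr
      exact hψb _
    · have hwm : Measurable (fun t : ℝ => (∫⁻ a, ‖κ a‖ₑ) * ENNReal.ofReal (bnd B T L t)) := by fun_prop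
      refine (fw_lint m hf hfM hwm).trans_lt ?_
      apply ENNReal.mul_lt_top hM.lt_top
      rw [lintegral_const_mul _ (by fun_prop)]
      exact ENNReal.mul_lt_top hκi hbi
  have hσ := swap23 m
  have e1 : ∀ z : (X × ℝ) × ℝ, (f (z.1.1, z.2) - f z.1) * (κ (z.2 - z.1.2) * ψ z.1) =
      (fun z : (X × ℝ) × ℝ => f z.1 * (κ (z.2 - z.1.2) * ψ (z.1.1, z.2))) ((z.1.1, z.2), z.1.2)
      - f z.1 * (κ (z.2 - z.1.2) * ψ z.1) := by
    intro z
    simp only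
    rw [show z.1.2 - z.2 = -(z.2 - z.1.2) by ring, hκe]
    ring
  have e2 : ∫ z, (f (z.1.1, z.2) - f z.1) * (κ (z.2 - z.1.2) * ψ z.1) ∂((m.prod volume).prod volume)
      = ∫ z, (f z.1 * (κ (z.2 - z.1.2) * ψ (z.1.1, z.2)) - f z.1 * (κ (z.2 - z.1.2) * ψ z.1))
        ∂((m.prod volume).prod volume) := by
    simp_rw [e1]
    have IA' := hσ.integrable_comp_of_integrable IA
    rw [integral_sub IA IA2]
    rw [integral_sub (by exact IA') IA2]
    congr 1
    have := integral_map (μ := (m.prod volume).prod volume) hσ.measurable.aemeasurable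
      (f := fun z : (X × ℝ) × ℝ => f z.1 * (κ (z.2 - z.1.2) * ψ (z.1.1, z.2)))
      (by rw [hσ.map_eq]; exact IA.1)
    rw [hσ.map_eq] at this
    exact this.symm
  have I12 : Integrable (fun z : (X × ℝ) × ℝ => f z.1 * (κ (z.2 - z.1.2) * ψ (z.1.1, z.2)) - f z.1 * (κ (z.2 - z.1.2) * ψ z.1)) ((m.prod volume).prod volume) := IA.sub IA2
  rw [e2, integral_prod _ I12]
  have e3 : ∀ p : X × ℝ, ∫ s, (f p * (κ (s - p.2) * ψ (p.1, s)) - f p * (κ (s - p.2) * ψ p))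
      = ∫ r, f p * h (p.1, p.2 + ε * r) * kE r := by
    intro p
    simp_rw [mul_assoc (f p)]
    rw [integral_const_mul (f p), ← (hN p.1).pot_diff hε p.2]
    have : ∀ s, f p * (κ (s - p.2) * ψ (p.1, s)) - f p * (κ (s - p.2) * ψ p)
      = f p * (κ (s - p.2) * (ψ (p.1, s) - ψ p)) := by intro s; ring
    simp_rw [this]
    rw [integral_const_mul (f p)]
    congr 1
    rw [← integral_add_left_eq_self (μ := volume)
      (fun s => κ (s - p.2) * (ψ (p.1, s) - ψ p)) p.2]
    simp only [add_sub_cancel_left]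
    rw [← integral_indicator (meas_abs_gt ε)]
    congr 1
    funext a
    by_cases ha : a ∈ {a : ℝ | ε < |a|}
    · rw [indicator_of_mem ha, hκ, indicator_of_mem ha]
    · rw [indicator_of_notMem ha, hκ, indicator_of_notMem ha, zero_mul]
  have e3' : (fun p : X × ℝ => ∫ s, (f p * (κ (s - p.2) * ψ (p.1, s)) - f p * (κ (s - p.2) * ψ p)))
      = fun p => ∫ r, f p * h (p.1, p.2 + ε * r) * kE r := funext e3
  have IF : Integrable (fun z : ℝ × (X × ℝ) => f z.2 * h (z.2.1, z.2.2 + ε * z.1) * kE z.1)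
      (volume.prod (m.prod volume)) := by
    have := kE_meas
    refine int_prod_of_bound (by fun_prop) (fun r => (M * (ENNReal.ofReal B * ENNReal.ofReal L))
      * ‖kE r‖ₑ) (fun r => ?_) ?_
    · simp only [enorm_mul _ (kE r)]
      rw [lintegral_mul_const _ (by fun_prop)]
      gcongr
      exact shift_lint m hf hfM hN (ε * r)
    · rw [lintegral_const_mul _ (by fun_prop)]
      exact ENNReal.mul_lt_top (ENNReal.mul_lt_top hM.lt_top
        (ENNReal.mul_lt_top ENNReal.ofReal_lt_top ENNReal.ofReal_lt_top)) kE_integrable.2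
  rw [e3', ← integral_integral_swap (f := fun r p => f p * h (p.1, p.2 + ε * r) * kE r) IF]
  congr 1
  funext r
  rw [integral_mul_const, mul_comm]
  rfl

theorem half_identity (m : Measure X) [SFinite m] {f : X × ℝ → ℝ} (hf : Measurable f) {M : ℝ≥0∞}
    (hM : M ≠ ⊤) (hfM : ∀ t, ∫⁻ x, ‖f (x, t)‖ₑ ∂m ≤ M) {h : X × ℝ → ℝ} (hh : Measurable h)
    {B T L : ℝ} (hN : ∀ x, Nice (fun s => h (x, s)) B T L) (hB : 0 ≤ B) (hL : 0 < L)
    (h0 : ∀ x, ∫ s, h (x, s) = 0) (hc : ∀ x, Continuous fun s => h (x, s))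
    (hD : ∫⁻ z, ‖(f (z.1.1, z.2) - f z.1) / |z.2 - z.1.2| ^ (3/2 : ℝ)‖ₑ *
      ENNReal.ofReal (bnd B T L z.1.2) ∂((m.prod volume).prod volume) < ⊤) :
    ∫ p, (∫ s, (f (p.1, s) - f p) / |s - p.2| ^ (3/2 : ℝ)) * pot (fun s => h (p.1, s)) p.2
      ∂(m.prod volume) = cE * ∫ p, f p * h p ∂(m.prod volume) := by
  set ψ : X × ℝ → ℝ := fun p => pot (fun s => h (p.1, s)) p.2 with hψ
  have hψm : Measurable ψ := pot_joint_meas hh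
  have hψb : ∀ p, ‖ψ p‖ₑ ≤ ENNReal.ofReal (bnd B T L p.2) := by
    intro p
    rw [← ofReal_norm]
    exact ENNReal.ofReal_le_ofReal ((hN p.1).le_bnd (h0 p.1) p.2)
  set G : (X × ℝ) × ℝ → ℝ := fun z =>
    (f (z.1.1, z.2) - f z.1) / |z.2 - z.1.2| ^ (3/2 : ℝ) * ψ z.1 with hG
  have IG : Integrable G ((m.prod volume).prod volume) := by
    refine ⟨(by fun_prop : Measurable G).aestronglyMeasurable, ?_⟩
    refine lt_of_le_of_lt (lintegral_mono fun z => ?_) hD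
    rw [hG, enorm_mul]
    gcongr
    exact hψb _
  have e1 : ∫ p, (∫ s, (f (p.1, s) - f p) / |s - p.2| ^ (3/2 : ℝ)) * ψ p ∂(m.prod volume)
      = ∫ z, G z ∂((m.prod volume).prod volume) := by
    rw [integral_prod _ IG]
    congr 1
    funext p
    rw [← integral_mul_const]
  rw [e1]
  set ε : ℕ → ℝ := fun k => 1 / ((k : ℝ) + 1) with hε
  have hε0 : ∀ k, 0 < ε k := fun k => by simp only [hε]; positivity
  have hεt : Tendsto ε atTop (𝓝 0) := tendsto_one_div_add_atTop_nhds_zero_nat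
  set S : ℕ → Set ((X × ℝ) × ℝ) := fun k => {z | ε k < |z.2 - z.1.2|} with hS
  have hSm : ∀ k, MeasurableSet (S k) := fun k => measurableSet_lt measurable_const (by fun_prop)
  have hmono : Monotone S := by
    intro j k hjk z hz
    simp only [hS, mem_ofPred_eq] at hz ⊢
    refine lt_of_le_of_lt ?_ hz
    simp only [hε]
    gcongr
  have t1 := tendsto_setIntegral_of_monotone hSm hmono (μ := (m.prod volume).prod volume)
    (f := G) IG.integrableOn
  have e2 : ∫ z in ⋃ k, S k, G z ∂((m.prod volume).prod volume)
      = ∫ z, G z ∂((m.prod volume).prod volume) := by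
    apply setIntegral_eq_integral_of_forall_compl_eq_zero
    intro z hz
    have : z.2 - z.1.2 = 0 := by
      by_contra hne
      apply hz
      have := (tendsto_order.1 hεt).2 _ (abs_pos.2 hne)
      obtain ⟨k, hk⟩ := this.exists
      exact mem_iUnion.2 ⟨k, hk⟩
    simp [hG, this]
  rw [e2] at t1
  have e3 : ∀ k, ∫ z in S k, G z ∂((m.prod volume).prod volume) = ∫ r, kE r * Psi m f h (ε k * r) := by
    intro k
    rw [← trunc_identity m hf hM hfM hh hN hB hL h0 (hε0 k), ← integral_indicator (hSm k)]
    congr 1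
    funext z
    by_cases hz : z ∈ S k
    · rw [indicator_of_mem hz, indicator_of_mem (show z.2 - z.1.2 ∈ {a : ℝ | ε k < |a|} from hz)]
      simp only [hG]
      rw [show (-3/2 : ℝ) = -(3/2) by norm_num, Real.rpow_neg (abs_nonneg _)]
      ring
    · rw [indicator_of_notMem hz, indicator_of_notMem (show z.2 - z.1.2 ∉ {a : ℝ | ε k < |a|} from hz)]
      ring
  simp_rw [e3] at t1
  have t2 : Tendsto (fun k => ∫ r, kE r * Psi m f h (ε k * r)) atTop
      (𝓝 (∫ r, kE r * Psi m f h 0)) := by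
    set C : ℝ := (M * (ENNReal.ofReal B * ENNReal.ofReal L)).toReal
    have hPb : ∀ δ, ‖Psi m f h δ‖ ≤ C := by
      intro δ
      have h1 := (enorm_integral_le_lintegral_enorm (μ := m.prod volume)
        (fun p => f p * h (p.1, p.2 + δ))).trans (shift_lint m hf hfM hN δ)
      have h2 : M * (ENNReal.ofReal B * ENNReal.ofReal L) ≠ ⊤ :=
        ENNReal.mul_ne_top hM (ENNReal.mul_ne_top ENNReal.ofReal_ne_top ENNReal.ofReal_ne_top)
      have := ENNReal.toReal_mono h2 h1
      rwa [toReal_enorm] at this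
    have hPm : Measurable (Psi m f h) := by
      have : StronglyMeasurable (fun z : ℝ × (X × ℝ) => f z.2 * h (z.2.1, z.2.2 + z.1)) := by
        apply Measurable.stronglyMeasurable
        fun_prop
      exact (this.integral_prod_right' (ν := m.prod volume)).measurable
    have := kE_meas
    apply tendsto_integral_of_dominated_convergence (fun r => |kE r| * C)
    · intro k
      exact (by fun_prop : Measurable _).aestronglyMeasurable
    · exact kE_integrable.abs.mul_const C
    · intro k
      refine ae_of_all _ fun r => ?_
      rw [norm_mul]
      exact mul_le_mul_of_nonneg_left (hPb _) (abs_nonneg _)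
    · refine ae_of_all _ fun r => ?_
      apply Tendsto.const_mul
      refine (Psi_tendsto m hf hM hfM hh hN hc).comp ?_
      simpa using hεt.mul_const r
  have := tendsto_nhds_unique t1 t2
  rw [this, integral_mul_const]
  simp [cE, Psi]

end abstractId

section heat
variable {n : ℕ}

lemma heatW_meas : Measurable (heatW : Pt n → ℝ) := by
  unfold heatW
  apply Measurable.ite (measurableSet_lt measurable_const measurable_snd) _ measurable_const
  fun_prop

lemma gradW_meas : Measurable (gradW : Pt n → Spc n) := by
  unfold gradW
  apply Measurable.ite (measurableSet_lt measurable_const measurable_snd) _ measurable_const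
  fun_prop

lemma heatW_nonneg (p : Pt n) : 0 ≤ heatW p := by
  unfold heatW
  split_ifs with h
  · have := pi_pos
    positivity
  · exact le_rfl

lemma heatW_zero {x : Spc n} {t : ℝ} (ht : t ≤ 0) : heatW (x, t) = 0 := by
  unfold heatW
  rw [if_neg (by simpa using ht)]

lemma heatW_int {t : ℝ} (ht : 0 < t) : ∫ x : Spc n, heatW (x, t) = 1 := by
  have e : ∀ x : Spc n, heatW (x, t) = (4 * π * t) ^ (-(n : ℝ) / 2) * rexp (-(1 / (4 * t)) * ‖x‖ ^ 2) := by
    intro x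
    unfold heatW
    rw [if_pos ht]
    congr 2
    show -‖x‖ ^ 2 / (4 * t) = _
    ring
  simp_rw [e]
  rw [integral_const_mul, GaussianFourier.integral_rexp_neg_mul_sq_norm (by positivity)]
  have : π / (1 / (4 * t)) = 4 * π * t := by field_simp
  rw [this, finrank_euclideanSpace_fin, ← rpow_add (by have := pi_pos; positivity), neg_div, neg_add_cancel,
    rpow_zero]

lemma heatW_integrable (t : ℝ) : Integrable (fun x : Spc n => heatW (x, t)) := by
  by_cases ht : 0 < t
  · apply Integrable.of_integral_ne_zero
    rw [heatW_int ht]; exact one_ne_zero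
  · have : (fun x : Spc n => heatW (x, t)) = fun _ => 0 := by
      funext x; exact heatW_zero (not_lt.1 ht)
    rw [this]
    exact integrable_zero _ _ _

lemma heatW_lint_le (t : ℝ) : ∫⁻ x : Spc n, ‖heatW (x, t)‖ₑ ≤ 1 := by
  by_cases ht : 0 < t
  · have : ∀ x : Spc n, ‖heatW (x, t)‖ₑ = ENNReal.ofReal (heatW (x, t)) := fun x =>
      Real.enorm_of_nonneg (heatW_nonneg _)
    simp_rw [this]
    rw [← ofReal_integral_eq_lintegral_ofReal (heatW_integrable t) (ae_of_all _ fun x => heatW_nonneg _),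
      heatW_int ht]
    simp
  · have : ∀ x : Spc n, ‖heatW (x, t)‖ₑ = 0 := by
      intro x
      rw [heatW_zero (not_lt.1 ht)]; simp
    simp_rw [this]
    simp

lemma heat_diff_two (s t : ℝ) : ∫⁻ x : Spc n, ‖heatW (x, s) - heatW (x, t)‖ₑ ≤ 2 := by
  calc _ ≤ ∫⁻ x : Spc n, (‖heatW (x, s)‖ₑ + ‖heatW (x, t)‖ₑ) := lintegral_mono fun x => enorm_sub_le
    _ = (∫⁻ x : Spc n, ‖heatW (x, s)‖ₑ) + ∫⁻ x : Spc n, ‖heatW (x, t)‖ₑ := by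
      apply lintegral_add_left
      have := heatW_meas (n := n)
      fun_prop
    _ ≤ 1 + 1 := add_le_add (heatW_lint_le s) (heatW_lint_le t)
    _ = 2 := by norm_num

lemma heat_diff_pos {s t : ℝ} (ht : 0 < t) (hts : t ≤ s) :
    ∫⁻ x : Spc n, ‖heatW (x, s) - heatW (x, t)‖ₑ ≤ ENNReal.ofReal (2 * (n * (s - t) / s)) := by
  have hs : 0 < s := ht.trans_le hts
  have hpi := pi_pos
  set θ : ℝ := (t / s) ^ ((n : ℝ) / 2) with hθ
  have hq : 0 < t / s := by positivity
  have hq1 : t / s ≤ 1 := (div_le_one hs).2 hts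
  have hθ1 : θ ≤ 1 := rpow_le_one hq.le hq1 (by positivity)
  have hθ0 : 0 ≤ θ := rpow_nonneg hq.le _
  have hθ2 : 1 - θ ≤ n * (s - t) / s := by
    have h1 : (t / s) ^ (n : ℝ) ≤ θ := rpow_le_rpow_of_exponent_ge hq hq1 (by
      have : (0:ℝ) ≤ n := by positivity
      linarith)
    rw [rpow_natCast] at h1
    have h2 := one_add_mul_le_pow (a := t / s - 1) (by linarith) n
    have h3 : 1 + (t / s - 1) = t / s := by ring
    rw [h3] at h2
    have h4 : (n : ℝ) * (s - t) / s = - (n * (t / s - 1)) := by field_simp; ring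
    rw [h4]; linarith
  have key : ∀ x : Spc n, θ * heatW (x, t) ≤ heatW (x, s) := by
    intro x
    unfold heatW
    rw [if_pos ht, if_pos hs]
    have e : (4 * π * s) ^ (-(n : ℝ) / 2) = θ * (4 * π * t) ^ (-(n : ℝ) / 2) := by
      rw [hθ, neg_div, rpow_neg (by positivity), rpow_neg (by positivity),
        show 4 * π * t = (t / s) * (4 * π * s) by field_simp, mul_rpow hq.le (by positivity)]
      have : (t / s) ^ ((n : ℝ) / 2) ≠ 0 := (rpow_pos_of_pos hq _).ne'
      field_simp
    show θ * ((4 * π * t) ^ (-(n : ℝ) / 2) * rexp (-‖x‖ ^ 2 / (4 * t))) ≤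
      (4 * π * s) ^ (-(n : ℝ) / 2) * rexp (-‖x‖ ^ 2 / (4 * s))
    rw [e, ← mul_assoc]
    refine mul_le_mul_of_nonneg_left (Real.exp_le_exp.2 ?_) (by positivity)
    rw [neg_div, neg_div]
    apply neg_le_neg
    gcongr
  have hb : ∀ x : Spc n, ‖heatW (x, s) - heatW (x, t)‖ₑ ≤
      ENNReal.ofReal ((heatW (x, s) - θ * heatW (x, t)) + (1 - θ) * heatW (x, t)) := by
    intro x
    rw [← ofReal_norm, Real.norm_eq_abs]
    apply ENNReal.ofReal_le_ofReal
    have := key x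
    have h1 := mul_nonneg (sub_nonneg.2 hθ1) (heatW_nonneg (x, t))
    rw [abs_le]; constructor <;> nlinarith
  refine (lintegral_mono hb).trans ?_
  have I1 := (heatW_integrable (n := n) s).sub ((heatW_integrable (n := n) t).const_mul θ)
  have I2 := (heatW_integrable (n := n) t).const_mul (1 - θ)
  have I3 : Integrable (fun x : Spc n => (heatW (x, s) - θ * heatW (x, t)) + (1 - θ) * heatW (x, t)) :=
    I1.add I2
  rw [← ofReal_integral_eq_lintegral_ofReal I3 (ae_of_all _ fun x => by
    have := key x
    have h1 := mul_nonneg (sub_nonneg.2 hθ1) (heatW_nonneg (x, t))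
    show 0 ≤ _
    linarith)]
  apply ENNReal.ofReal_le_ofReal
  rw [integral_add (by exact I1) I2, integral_sub (heatW_integrable s) ((heatW_integrable t).const_mul θ),
    integral_const_mul, integral_const_mul, heatW_int ht, heatW_int hs]
  linarith

/-- modulus for time differences -/
def beta (n : ℕ) (a r : ℝ) : ℝ := if |a| ≤ |r| then n * |a| / |r| else 1

lemma beta_meas (n : ℕ) : Measurable (fun z : ℝ × ℝ => beta n z.1 z.2) := by
  unfold beta
  apply Measurable.ite (measurableSet_le (by fun_prop) (by fun_prop)) (by fun_prop) (by fun_prop)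

lemma heat_diff (hn : 1 ≤ n) (s t : ℝ) :
    ∫⁻ x : Spc n, ‖heatW (x, s) - heatW (x, t)‖ₑ ≤ ENNReal.ofReal (2 * beta n (s - t) t) := by
  have hn' : (1:ℝ) ≤ n := by exact_mod_cast hn
  unfold beta
  split_ifs with h
  · rcases le_or_gt t 0 with ht | ht
    · have hs : s ≤ 0 := by
        rw [abs_of_nonpos ht] at h
        have := le_abs_self (s - t)
        linarith
      have : ∀ x : Spc n, ‖heatW (x, s) - heatW (x, t)‖ₑ = 0 := by
        intro x; rw [heatW_zero hs, heatW_zero ht]; simp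
      simp_rw [this]; simp
    · rw [abs_of_pos ht] at h ⊢
      rcases le_or_gt t s with hts | hts
      · refine (heat_diff_pos ht hts).trans ?_
        apply ENNReal.ofReal_le_ofReal
        rw [abs_of_nonneg (by linarith)]
        have : 0 ≤ (n:ℝ) * (s - t) := mul_nonneg (by positivity) (by linarith)
        gcongr
      · rcases le_or_gt s 0 with hs | hs
        · refine (heat_diff_two s t).trans ?_
          rw [show (2 : ℝ≥0∞) = ENNReal.ofReal 2 by simp]
          apply ENNReal.ofReal_le_ofReal
          have h1 : t ≤ |s - t| := by
            rw [abs_sub_comm]; have := le_abs_self (t - s); linarith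
          have : (1:ℝ) ≤ n * |s - t| / t := by
            rw [le_div_iff₀ ht]; nlinarith
          linarith
        · have : ∀ x : Spc n, ‖heatW (x, s) - heatW (x, t)‖ₑ = ‖heatW (x, t) - heatW (x, s)‖ₑ :=
            fun x => enorm_sub_rev _ _
          simp_rw [this]
          refine (heat_diff_pos hs hts.le).trans ?_
          rw [abs_sub_comm, abs_of_nonneg (by linarith : 0 ≤ t - s)]
  · refine (heat_diff_two s t).trans ?_
    simp

lemma beta_lint {r : ℝ} (hr : r ≠ 0) :
    ∫⁻ a, ENNReal.ofReal (2 * beta n a r) * ENNReal.ofReal (|a| ^ (-3/2 : ℝ)) ≤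
      ENNReal.ofReal (8 * n + 8) * ENNReal.ofReal (|r| ^ (-1/2 : ℝ)) := by
  have hr' : 0 < |r| := abs_pos.2 hr
  have hp : ∀ a, ENNReal.ofReal (2 * beta n a r) * ENNReal.ofReal (|a| ^ (-3/2 : ℝ)) ≤
      (Icc (-|r|) |r|).indicator (fun a => ENNReal.ofReal (2 * n / |r|) * ENNReal.ofReal (|a| ^ (-1/2 : ℝ))) a
      + ({a : ℝ | |r| < |a|}).indicator (fun a => 2 * ENNReal.ofReal (|a| ^ (-3/2 : ℝ))) a := by
    intro a
    by_cases h : |a| ≤ |r|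
    · rw [indicator_of_mem (by rw [mem_Icc]; exact abs_le.1 h), beta, if_pos h]
      refine le_add_right ?_
      rw [← ENNReal.ofReal_mul' (by positivity), ← ENNReal.ofReal_mul' (by positivity)]
      apply ENNReal.ofReal_le_ofReal
      by_cases ha : a = 0
      · subst ha; simp
      · have ha' : 0 < |a| := abs_pos.2 ha
        rw [rpow_n3 ha', rpow_n1 ha'.le]
        apply le_of_eq
        field_simp
    · rw [indicator_of_mem (s := {a : ℝ | |r| < |a|}) (by simpa using h), beta, if_neg h]
      refine le_add_left ?_
      simp
  refine (lintegral_mono hp).trans ?_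
  rw [lintegral_add_left (by
    apply Measurable.indicator _ measurableSet_Icc
    fun_prop), lintegral_indicator measurableSet_Icc, lintegral_indicator (meas_abs_gt _),
    lintegral_const_mul _ (by fun_prop), lintegral_const_mul _ (by fun_prop), half_lint _ hr']
  have h3 : ∫⁻ a in {a : ℝ | |r| < |a|}, ENNReal.ofReal (|a| ^ (-3/2 : ℝ)) =
      ENNReal.ofReal (4 * |r| ^ (-1/2 : ℝ)) := by
    rw [← ofReal_integral_eq_lintegral_ofReal (three_integrable hr') (ae_of_all _ fun a => by
      show 0 ≤ _
      positivity)]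
    rw [(integral_abs_gt (F := fun a : ℝ => |a| ^ (-3/2 : ℝ)) hr' (int_three hr').1
      (by simp only [abs_neg]; exact (int_three hr').1)).2]
    simp only [abs_neg]
    rw [(int_three hr').2, rpow_n1 hr'.le]
    congr 1; ring
  rw [h3, ← ENNReal.ofReal_mul' (by positivity), ← ENNReal.ofReal_mul' (by positivity),
    show (2 : ℝ≥0∞) = ENNReal.ofReal 2 by simp, ← ENNReal.ofReal_mul' (by positivity),
    ← ENNReal.ofReal_add (by positivity) (by positivity)]
  apply ENNReal.ofReal_le_ofReal
  rw [rpow_n1 hr'.le]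
  have hs := Real.mul_self_sqrt hr'.le
  have hs0 := Real.sqrt_pos.2 hr'
  apply le_of_eq
  have : 2 * (n:ℝ) / |r| * (4 * √|r|) = 8 * n / √|r| := by
    field_simp
    nlinarith [Real.sq_sqrt hr'.le]
  rw [this]
  field_simp
  ring

lemma grad_le (x : Spc n) {t : ℝ} (ht : 0 < t) :
    ‖gradW (x, t)‖ ≤ (2 : ℝ) ^ ((n : ℝ) / 2) * |t| ^ (-1/2 : ℝ) * heatW (x, 2 * t) := by
  have hpi := pi_pos
  unfold gradW heatW
  rw [if_pos ht, if_pos (by show 0 < 2 * t; linarith)]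
  rw [norm_smul, norm_mul, norm_mul, norm_neg, Real.norm_of_nonneg (by positivity),
    Real.norm_of_nonneg (by positivity), Real.norm_of_nonneg (by positivity)]
  simp only
  rw [abs_of_pos ht, rpow_n1 ht.le]
  have e1 : (4 * π * (2 * t)) ^ (-(n : ℝ) / 2) = (2:ℝ) ^ (-(n : ℝ) / 2) * (4 * π * t) ^ (-(n : ℝ) / 2) := by
    rw [← mul_rpow (by norm_num) (by positivity)]
    congr 1; ring
  have e2 : (2:ℝ) ^ ((n : ℝ) / 2) * (2:ℝ) ^ (-(n : ℝ) / 2) = 1 := by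
    rw [← rpow_add (by norm_num)]; ring_nf; simp
  have e3 : rexp (-‖x‖ ^ 2 / (4 * t)) = rexp (-‖x‖ ^ 2 / (4 * (2 * t))) * rexp (-‖x‖ ^ 2 / (4 * (2 * t))) := by
    rw [← Real.exp_add]; congr 1; field_simp; ring
  set E := rexp (-‖x‖ ^ 2 / (4 * (2 * t))) with hE
  set P := (4 * π * t) ^ (-(n : ℝ) / 2) with hP
  have hP0 : 0 ≤ P := by positivity
  have hE0 : 0 ≤ E := (Real.exp_pos _).le
  rw [e1, e3]
  have key : ‖x‖ * E ≤ 2 * √t := by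
    have h1 : 1 + ‖x‖ ^ 2 / (8 * t) ≤ rexp (‖x‖ ^ 2 / (8 * t)) := by
      have := Real.add_one_le_exp (‖x‖ ^ 2 / (8 * t)); linarith
    have h2 : E = (rexp (‖x‖ ^ 2 / (8 * t)))⁻¹ := by
      rw [hE, ← Real.exp_neg]; congr 1; ring
    rw [h2, ← div_eq_mul_inv, div_le_iff₀ (Real.exp_pos _)]
    have hs := Real.mul_self_sqrt ht.le
    have hs0 := Real.sqrt_pos.2 ht
    have h3 : ‖x‖ ≤ 2 * √t * (1 + ‖x‖ ^ 2 / (8 * t)) := by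
      have : 2 * √t * (1 + ‖x‖ ^ 2 / (8 * t)) = (8 * √t ^ 2 + ‖x‖ ^ 2) / (4 * √t) := by
        rw [Real.sq_sqrt ht.le]
        field_simp
        rw [Real.sq_sqrt ht.le]
        ring
      rw [this, le_div_iff₀ (by positivity)]
      nlinarith [sq_nonneg (‖x‖ - 2 * √t), sq_nonneg √t]
    exact h3.trans (by gcongr)
  calc 1 / (2 * t) * P * (E * E) * ‖x‖ = 1 / (2 * t) * P * E * (‖x‖ * E) := by ring
    _ ≤ 1 / (2 * t) * P * E * (2 * √t) := by gcongr
    _ = 1 / √t * (P * E) := by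
      have := Real.mul_self_sqrt ht.le
      have hs0 := Real.sqrt_pos.2 ht
      have : 1 / (2 * t) * (2 * √t) = 1 / √t := by
        field_simp
        exact Real.sq_sqrt ht.le
      rw [← this]; ring
    _ = ((2:ℝ) ^ ((n : ℝ) / 2) * (2:ℝ) ^ (-(n : ℝ) / 2)) * (1 / √t * (P * E)) := by rw [e2, one_mul]
    _ = _ := by ring

lemma grad_lint (t : ℝ) : ∫⁻ x : Spc n, ‖gradW (x, t)‖ₑ ≤
    ENNReal.ofReal ((2 : ℝ) ^ ((n : ℝ) / 2)) * ENNReal.ofReal (|t| ^ (-1/2 : ℝ)) := by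
  rcases le_or_gt t 0 with ht | ht
  · have : ∀ x : Spc n, ‖gradW (x, t)‖ₑ = 0 := by
      intro x; unfold gradW; rw [if_neg (by simpa using ht)]; simp
    simp_rw [this]; simp
  · calc _ ≤ ∫⁻ x : Spc n, ENNReal.ofReal ((2 : ℝ) ^ ((n : ℝ) / 2)) * ENNReal.ofReal (|t| ^ (-1/2 : ℝ)) *
          ‖heatW (x, 2 * t)‖ₑ := by
          apply lintegral_mono
          intro x
          beta_reduce
          rw [Real.enorm_of_nonneg (heatW_nonneg _), ← ofReal_norm,
            ← ENNReal.ofReal_mul (by positivity), ← ENNReal.ofReal_mul (by positivity)]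
          exact ENNReal.ofReal_le_ofReal (grad_le x ht)
      _ = ENNReal.ofReal ((2 : ℝ) ^ ((n : ℝ) / 2)) * ENNReal.ofReal (|t| ^ (-1/2 : ℝ)) *
          ∫⁻ x : Spc n, ‖heatW (x, 2 * t)‖ₑ := by
          apply lintegral_const_mul
          have := heatW_meas (n := n)
          fun_prop
      _ ≤ _ := by
          exact mul_le_of_le_one_right' (heatW_lint_le _)
end heat

section rep
variable {n : ℕ}

/-- spatial derivative -/
def dx (φ : Pt n → ℝ) (p : Pt n) : Spc n →L[ℝ] ℝ := fderiv ℝ (fun y : Spc n => φ (y, p.2)) p.1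
/-- time derivative -/
def dt (φ : Pt n → ℝ) (p : Pt n) : ℝ := deriv (fun s : ℝ => φ (p.1, s)) p.2

structure Tst (φ : Pt n → ℝ) (A A' T L : ℝ) : Prop where
  cd : ContDiff ℝ 1 φ
  supp : ∀ p : Pt n, p.2 ∉ Icc T (T + L) → φ p = 0
  dxb : ∀ p, ‖dx φ p‖ ≤ A'
  dxs : ∀ p : Pt n, p.2 ∉ Icc T (T + L) → dx φ p = 0
  dtb : ∀ p, ‖dt φ p‖ ≤ A
  dts : ∀ p : Pt n, p.2 ∉ Icc T (T + L) → dt φ p = 0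

lemma dx_eq {φ : Pt n → ℝ} (h : ContDiff ℝ 1 φ) (p : Pt n) :
    dx φ p = (fderiv ℝ φ p).comp (ContinuousLinearMap.inl ℝ (Spc n) ℝ) := by
  have h1 : HasFDerivAt φ (fderiv ℝ φ p) (p.1, p.2) := (h.differentiable one_ne_zero p).hasFDerivAt
  have h2 : HasFDerivAt (fun y : Spc n => (y, p.2)) (ContinuousLinearMap.inl ℝ (Spc n) ℝ) p.1 :=
    hasFDerivAt_prodMk_left p.1 p.2
  exact (h1.comp p.1 h2).fderiv

lemma dt_eq {φ : Pt n → ℝ} (h : ContDiff ℝ 1 φ) (p : Pt n) :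
    dt φ p = fderiv ℝ φ p (0, 1) := by
  have h1 : HasFDerivAt φ (fderiv ℝ φ p) (p.1, p.2) := (h.differentiable one_ne_zero p).hasFDerivAt
  have h2 : HasDerivAt (fun s : ℝ => (p.1, s)) ((0 : Spc n), (1:ℝ)) p.2 :=
    (hasDerivAt_const p.2 p.1).prodMk (hasDerivAt_id p.2)
  exact (h1.comp_hasDerivAt p.2 h2).deriv

lemma fd_cont {φ : Pt n → ℝ} (h : ContDiff ℝ 1 φ) : Continuous (fderiv ℝ φ) :=
  h.continuous_fderiv one_ne_zero

lemma dt_cont {φ : Pt n → ℝ} (h : ContDiff ℝ 1 φ) : Continuous (dt φ) := by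
  have : dt φ = fun p => fderiv ℝ φ p (0, 1) := funext (dt_eq h)
  rw [this]
  exact (fd_cont h).clm_apply continuous_const

lemma dx_cont {φ : Pt n → ℝ} (h : ContDiff ℝ 1 φ) :
    Continuous fun z : Pt n × Spc n => dx φ z.1 z.2 := by
  have : (fun z : Pt n × Spc n => dx φ z.1 z.2) = fun z => fderiv ℝ φ z.1 (z.2, 0) := by
    funext z; rw [dx_eq h]; rfl
  rw [this]
  exact ((fd_cont h).comp continuous_fst).clm_apply (by fun_prop)

lemma slab_heat (y : Pt n) {w : ℝ → ℝ≥0∞} (hw : Measurable w) :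
    ∫⁻ p, ‖heatW (p - y)‖ₑ * w p.2 ≤ ∫⁻ t, w t := by
  have hm := heatW_meas (n := n)
  rw [Measure.volume_eq_prod, lintegral_prod_symm' _ (by fun_prop)]
  apply lintegral_mono
  intro t
  show ∫⁻ x : Spc n, ‖heatW ((x, t) - y)‖ₑ * w t ≤ w t
  rw [lintegral_mul_const _ (by fun_prop)]
  apply mul_le_of_le_one_left'
  have : ∀ x : Spc n, ‖heatW ((x, t) - y)‖ₑ = (fun x => ‖heatW (x, t - y.2)‖ₑ) (x - y.1) := fun x => rfl
  simp_rw [this]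
  rw [lintegral_sub_right_eq_self (fun x : Spc n => ‖heatW (x, t - y.2)‖ₑ) y.1]
  exact heatW_lint_le _

lemma slab_grad (y : Pt n) {w : ℝ → ℝ≥0∞} (hw : Measurable w) {B : ℝ≥0∞} (hB : ∀ t, w t ≤ B) :
    ∫⁻ p, ‖gradW (p - y)‖ₑ * w p.2 ≤ ENNReal.ofReal ((2 : ℝ) ^ ((n : ℝ) / 2)) *
      (ENNReal.ofReal (4 * √1) * B + ENNReal.ofReal ((1:ℝ) ^ (-1/2 : ℝ)) * ∫⁻ t, w t) := by
  have hm := gradW_meas (n := n)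
  rw [Measure.volume_eq_prod, lintegral_prod_symm' _ (by fun_prop)]
  refine le_trans ?_ (mul_le_mul_right (half_conv w hw B hB one_pos y.2) _)
  rw [← lintegral_const_mul _ (by fun_prop)]
  apply lintegral_mono
  intro t
  show ∫⁻ x : Spc n, ‖gradW ((x, t) - y)‖ₑ * w t ≤ ENNReal.ofReal ((2 : ℝ) ^ ((n : ℝ) / 2)) *
    (ENNReal.ofReal (|t - y.2| ^ (-1/2 : ℝ)) * w t)
  rw [lintegral_mul_const _ (by fun_prop), ← mul_assoc]
  gcongr
  have : ∀ x : Spc n, ‖gradW ((x, t) - y)‖ₑ = (fun x => ‖gradW (x, t - y.2)‖ₑ) (x - y.1) := fun x => rfl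
  simp_rw [this]
  rw [lintegral_sub_right_eq_self (fun x : Spc n => ‖gradW (x, t - y.2)‖ₑ) y.1]
  exact grad_lint _

/-- slab indicator weight -/
def slab (T L A : ℝ) (t : ℝ) : ℝ≥0∞ := (Icc T (T + L)).indicator (fun _ => ENNReal.ofReal A) t

lemma slab_meas (T L A : ℝ) : Measurable (slab T L A) := measurable_const.indicator measurableSet_Icc
lemma slab_le (T L A t : ℝ) : slab T L A t ≤ ENNReal.ofReal A := by
  unfold slab; exact indicator_le_self _ _ _
lemma slab_int (T L A : ℝ) : ∫⁻ t, slab T L A t = ENNReal.ofReal A * ENNReal.ofReal L := by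
  unfold slab
  rw [lintegral_indicator measurableSet_Icc, setLIntegral_const, Real.volume_Icc, add_sub_cancel_left]

lemma Tst.dx_slab {φ : Pt n → ℝ} {A A' T L : ℝ} (H : Tst φ A A' T L) (p : Pt n) :
    ‖dx φ p‖ₑ ≤ slab T L A' p.2 := by
  unfold slab
  by_cases hp : p.2 ∈ Icc T (T + L)
  · rw [indicator_of_mem hp, ← ofReal_norm]; exact ENNReal.ofReal_le_ofReal (H.dxb p)
  · rw [H.dxs p hp, ← ofReal_norm, norm_zero, ENNReal.ofReal_zero]; exact zero_le

lemma Tst.dt_slab {φ : Pt n → ℝ} {A A' T L : ℝ} (H : Tst φ A A' T L) (p : Pt n) :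
    ‖dt φ p‖ₑ ≤ slab T L A p.2 := by
  unfold slab
  by_cases hp : p.2 ∈ Icc T (T + L)
  · rw [indicator_of_mem hp, ← ofReal_norm]; exact ENNReal.ofReal_le_ofReal (H.dtb p)
  · rw [H.dts p hp]; simp

/-- the kernel of the representation formula -/
def Kr (φ : Pt n → ℝ) (y p : Pt n) : ℝ := dx φ p (gradW (p - y)) - heatW (p - y) * dt φ p

lemma Kr_meas {φ : Pt n → ℝ} (h : ContDiff ℝ 1 φ) : Measurable fun z : Pt n × Pt n => Kr φ z.1 z.2 := by
  unfold Kr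
  have h1 := (dx_cont h).measurable
  have h2 := (dt_cont h).measurable
  have hm := gradW_meas (n := n)
  have hm' := heatW_meas (n := n)
  apply Measurable.sub
  · exact h1.comp (g := fun z : Pt n × Spc n => dx φ z.1 z.2)
      (f := fun z : Pt n × Pt n => (z.2, gradW (z.2 - z.1))) (by fun_prop)
  · fun_prop

lemma Kr_lint {φ : Pt n → ℝ} {A A' T L : ℝ} (H : Tst φ A A' T L) :
    ∃ M : ℝ≥0∞, M < ⊤ ∧ ∀ y, ∫⁻ p, ‖Kr φ y p‖ₑ ≤ M := by
  refine ⟨ENNReal.ofReal ((2 : ℝ) ^ ((n : ℝ) / 2)) *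
      (ENNReal.ofReal (4 * √1) * ENNReal.ofReal A' + ENNReal.ofReal ((1:ℝ) ^ (-1/2 : ℝ)) *
        ∫⁻ t, slab T L A' t) + ∫⁻ t, slab T L A t, ?_, fun y => ?_⟩
  · rw [slab_int, slab_int]
    finiteness
  · have hm := gradW_meas (n := n)
    have hs := slab_meas T L A'
    refine le_trans ?_ (add_le_add (slab_grad y (slab_meas T L A') (slab_le T L A'))
      (slab_heat y (slab_meas T L A)))
    rw [← lintegral_add_left (by fun_prop)]
    apply lintegral_mono
    intro p
    show ‖dx φ p (gradW (p - y)) - heatW (p - y) * dt φ p‖ₑ ≤ _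
    refine enorm_sub_le.trans (add_le_add ?_ ?_)
    · rw [mul_comm]
      exact (ContinuousLinearMap.le_opENorm _ _).trans (mul_le_mul_left (H.dx_slab p) _)
    · rw [enorm_mul]
      exact mul_le_mul_right (H.dt_slab p) _

/-- derivative along parabolas -/
def Fp (φ : Pt n → ℝ) (y : Pt n) (ξ : Spc n) (τ : ℝ) : ℝ :=
  1 / (2 * √τ) * dx φ (y.1 + √τ • ξ, y.2 + τ) ξ + dt φ (y.1 + √τ • ξ, y.2 + τ)

lemma Fp_meas {φ : Pt n → ℝ} (h : ContDiff ℝ 1 φ) (y : Pt n) :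
    Measurable fun z : Spc n × ℝ => Fp φ y z.1 z.2 := by
  unfold Fp
  have h1 := (dx_cont h).measurable
  have h2 := (dt_cont h).measurable
  apply Measurable.add
  · apply Measurable.mul (by fun_prop)
    exact h1.comp (g := fun z : Pt n × Spc n => dx φ z.1 z.2)
      (f := fun z : Spc n × ℝ => ((y.1 + √z.2 • z.1, y.2 + z.2), z.1)) (by fun_prop)
  · fun_prop

lemma Fp_lint {φ : Pt n → ℝ} {A A' T L : ℝ} (H : Tst φ A A' T L) (y : Pt n) :
    ∃ M : ℝ≥0∞, M < ⊤ ∧ ∀ ξ, ∫⁻ τ in Ioi (0:ℝ), ‖Fp φ y ξ τ‖ₑ ≤ ‖ξ‖ₑ * M + M := by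
  set M1 := (ENNReal.ofReal (4 * √1) * ENNReal.ofReal A' + ENNReal.ofReal ((1:ℝ) ^ (-1/2 : ℝ)) *
        ∫⁻ t, slab T L A' t)
  set M2 := ∫⁻ t, slab T L A t
  have f1 : M1 < ⊤ := by
    simp only [M1, slab_int]; finiteness
  have f2 : M2 < ⊤ := by
    simp only [M2, slab_int]; finiteness
  have hs := slab_meas T L A'
  have hs' := slab_meas T L A
  refine ⟨M1 + M2, ENNReal.add_lt_top.2 ⟨f1, f2⟩, fun ξ => ?_⟩
  have hp : ∀ τ ∈ Ioi (0:ℝ), ‖Fp φ y ξ τ‖ₑ ≤ ‖ξ‖ₑ * (ENNReal.ofReal (|y.2 + τ - y.2| ^ (-1/2 : ℝ)) *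
      slab T L A' (y.2 + τ)) + slab T L A (y.2 + τ) := by
    intro τ hτ
    unfold Fp
    refine (enorm_add_le _ _).trans (add_le_add ?_ (H.dt_slab _))
    rw [enorm_mul]
    have e1 : ‖(1 / (2 * √τ) : ℝ)‖ₑ ≤ ENNReal.ofReal (|y.2 + τ - y.2| ^ (-1/2 : ℝ)) := by
      rw [← ofReal_norm, Real.norm_of_nonneg (by positivity)]
      apply ENNReal.ofReal_le_ofReal
      rw [add_sub_cancel_left, abs_of_pos hτ, rpow_n1 (le_of_lt hτ)]
      have : 0 < √τ := Real.sqrt_pos.2 hτ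
      gcongr
      linarith
    calc _ ≤ ENNReal.ofReal (|y.2 + τ - y.2| ^ (-1/2 : ℝ)) * (slab T L A' (y.2 + τ) * ‖ξ‖ₑ) :=
          mul_le_mul' e1 ((ContinuousLinearMap.le_opENorm _ _).trans
            (mul_le_mul_left (H.dx_slab _) _))
      _ = _ := by ring
  calc _ ≤ ∫⁻ τ in Ioi (0:ℝ), (‖ξ‖ₑ * (ENNReal.ofReal (|y.2 + τ - y.2| ^ (-1/2 : ℝ)) *
      slab T L A' (y.2 + τ)) + slab T L A (y.2 + τ)) := setLIntegral_mono (by fun_prop) hp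
    _ ≤ ∫⁻ τ, (‖ξ‖ₑ * (ENNReal.ofReal (|y.2 + τ - y.2| ^ (-1/2 : ℝ)) *
      slab T L A' (y.2 + τ)) + slab T L A (y.2 + τ)) := setLIntegral_le_lintegral _ _
    _ = ‖ξ‖ₑ * (∫⁻ t, ENNReal.ofReal (|t - y.2| ^ (-1/2 : ℝ)) * slab T L A' t) + M2 := by
      rw [lintegral_add_left (by fun_prop), lintegral_const_mul _ (by fun_prop),
        lintegral_add_left_eq_self (fun t => slab T L A t) y.2,
        lintegral_add_left_eq_self (fun t => ENNReal.ofReal (|t - y.2| ^ (-1/2 : ℝ)) * slab T L A' t) y.2]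
    _ ≤ _ := by
      gcongr
      · exact (half_conv _ hs _ (slab_le T L A') one_pos y.2).trans le_self_add
      · exact le_add_self

lemma Fp_int {φ : Pt n → ℝ} {A A' T L : ℝ} (H : Tst φ A A' T L) (y : Pt n) (ξ : Spc n) :
    IntegrableOn (Fp φ y ξ) (Ioi 0) ∧ ∫ τ in Ioi (0:ℝ), Fp φ y ξ τ = - φ y := by
  obtain ⟨M, hM, hb⟩ := Fp_lint H y
  have I : IntegrableOn (Fp φ y ξ) (Ioi 0) := by
    refine ⟨((Fp_meas H.cd y).comp (f := fun τ : ℝ => (ξ, τ)) (by fun_prop)).aestronglyMeasurable, ?_⟩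
    refine (hb ξ).trans_lt ?_
    finiteness
  refine ⟨I, ?_⟩
  have hcont : Continuous fun τ : ℝ => φ (y.1 + √τ • ξ, y.2 + τ) :=
    H.cd.continuous.comp (by fun_prop)
  have := integral_Ioi_of_hasDerivAt_of_tendsto (a := 0) (m := 0)
    (f := fun τ : ℝ => φ (y.1 + √τ • ξ, y.2 + τ)) (f' := Fp φ y ξ)
    hcont.continuousWithinAt ?_ I ?_
  · rw [this]; simp
  · intro τ hτ
    have hτ' : (0:ℝ) < τ := hτ
    have h1 : HasFDerivAt φ _ (y.1 + √τ • ξ, y.2 + τ) := (H.cd.differentiable one_ne_zero _).hasFDerivAt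
    have h2 : HasDerivAt (fun τ : ℝ => (y.1 + √τ • ξ, y.2 + τ)) ((1 / (2 * √τ)) • ξ, (1:ℝ)) τ :=
      (((Real.hasDerivAt_sqrt hτ'.ne').smul_const ξ).const_add y.1).prodMk
        ((hasDerivAt_id τ).const_add y.2)
    refine (h1.comp_hasDerivAt τ h2).congr_deriv ?_
    unfold Fp
    rw [dx_eq H.cd, dt_eq H.cd, ContinuousLinearMap.comp_apply, ContinuousLinearMap.inl_apply,
      ← smul_eq_mul (1 / (2 * √τ)), ← map_smul, ← map_add]
    simp
  · refine tendsto_const_nhds.congr' ?_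
    filter_upwards [eventually_gt_atTop (T + L - y.2)] with τ hτ
    symm
    apply H.supp
    intro h
    have := h.2
    simp only at this
    linarith

lemma heat_scale (ξ : Spc n) {τ : ℝ} (hτ : 0 < τ) :
    √τ ^ n * heatW (√τ • ξ, τ) = heatW (ξ, 1) := by
  have hpi := pi_pos
  unfold heatW
  rw [if_pos hτ, if_pos one_pos]
  simp only
  rw [norm_smul, mul_pow, Real.norm_of_nonneg (Real.sqrt_nonneg _), Real.sq_sqrt hτ.le,
    mul_rpow (by positivity) hτ.le, mul_one, mul_one]
  have e1 : √τ ^ n * τ ^ (-(n:ℝ) / 2) = 1 := by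
    rw [Real.sqrt_eq_rpow, ← rpow_natCast, ← rpow_mul hτ.le, ← rpow_add hτ]
    ring_nf; simp
  have e2 : -(τ * ‖ξ‖ ^ 2) / (4 * τ) = -‖ξ‖ ^ 2 / 4 := by field_simp
  rw [e2]
  calc _ = (√τ ^ n * τ ^ (-(n:ℝ) / 2)) * ((4 * π) ^ (-(n:ℝ) / 2) * rexp (-‖ξ‖ ^ 2 / 4)) := by ring
    _ = _ := by rw [e1, one_mul]

lemma grad_heat (z : Spc n) {τ : ℝ} (hτ : 0 < τ) : gradW (z, τ) = (-(1 / (2 * τ)) * heatW (z, τ)) • z := by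
  unfold gradW heatW
  rw [if_pos hτ, if_pos hτ]
  simp only [mul_assoc]

lemma Kr_slice (φ : Pt n → ℝ) (y : Pt n) {τ : ℝ} (hτ : 0 < τ) :
    ∫ x : Spc n, Kr φ y (x, y.2 + τ) = - ∫ ξ : Spc n, heatW (ξ, 1) * Fp φ y ξ τ := by
  have hs : 0 < √τ := Real.sqrt_pos.2 hτ
  rw [← integral_add_left_eq_self (fun x : Spc n => Kr φ y (x, y.2 + τ)) y.1]
  have h1 := Measure.integral_comp_smul (volume : Measure (Spc n))
    (fun z : Spc n => Kr φ y (y.1 + z, y.2 + τ)) √τ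
  rw [finrank_euclideanSpace_fin] at h1
  have h2 : ∫ z : Spc n, Kr φ y (y.1 + z, y.2 + τ) =
      √τ ^ n * ∫ ξ : Spc n, Kr φ y (y.1 + √τ • ξ, y.2 + τ) := by
    rw [h1, abs_of_pos (by positivity), smul_eq_mul, ← mul_assoc, mul_inv_cancel₀ (by positivity), one_mul]
  rw [h2, ← integral_const_mul, ← integral_neg]
  congr 1
  funext ξ
  unfold Kr Fp
  have e : ((y.1 + √τ • ξ, y.2 + τ) : Pt n) - y = (√τ • ξ, τ) := by
    ext1
    · simp
    · simp
  rw [e, grad_heat _ hτ, map_smul, map_smul, smul_eq_mul, smul_eq_mul, ← heat_scale ξ hτ]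
  have : 1 / (2 * τ) * √τ = 1 / (2 * √τ) := by
    field_simp
    exact Real.sq_sqrt hτ.le
  rw [← this]
  ring

theorem Kr_rep {φ : Pt n → ℝ} {A A' T L : ℝ} (H : Tst φ A A' T L) (y : Pt n) :
    ∫ p, Kr φ y p = φ y := by
  obtain ⟨M, hM, hb⟩ := Kr_lint H
  have I : Integrable (Kr φ y) (volume.prod volume) := by
    refine ⟨((Kr_meas H.cd).comp (f := fun p : Pt n => (y, p)) (by fun_prop)).aestronglyMeasurable, ?_⟩
    exact (hb y).trans_lt hM
  rw [Measure.volume_eq_prod, integral_prod_symm _ I]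
  rw [← integral_add_left_eq_self (fun t : ℝ => ∫ x : Spc n, Kr φ y (x, t)) y.2]
  have e1 : (fun τ : ℝ => ∫ x : Spc n, Kr φ y (x, y.2 + τ)) = (Ioi (0:ℝ)).indicator
      (fun τ => - ∫ ξ : Spc n, heatW (ξ, 1) * Fp φ y ξ τ) := by
    funext τ
    by_cases hτ : τ ∈ Ioi (0:ℝ)
    · rw [indicator_of_mem hτ, Kr_slice φ y hτ]
    · rw [indicator_of_notMem hτ]
      have : ∀ x : Spc n, Kr φ y (x, y.2 + τ) = 0 := by
        intro x
        have e : ((x, y.2 + τ) : Pt n) - y = (x - y.1, τ) := by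
          ext1
          · simp
          · simp
        unfold Kr
        rw [e, heatW_zero (not_lt.1 hτ)]
        unfold gradW
        rw [if_neg (by simpa using hτ)]
        simp
      simp_rw [this]; simp
  rw [e1, integral_indicator measurableSet_Ioi, integral_neg]
  obtain ⟨M', hM', hb'⟩ := Fp_lint H y
  have IF : Integrable (fun z : Spc n × ℝ => heatW (z.1, 1) * Fp φ y z.1 z.2)
      (volume.prod (volume.restrict (Ioi (0:ℝ)))) := by
    have m1 := heatW_meas (n := n)
    have m2 := Fp_meas H.cd y
    refine int_prod_of_bound (by fun_prop) (fun ξ => ‖heatW (ξ, 1)‖ₑ * (‖ξ‖ₑ * M' + M')) (fun ξ => ?_) ?_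
    · simp only [enorm_mul]
      rw [lintegral_const_mul _ (by
        exact ((Fp_meas H.cd y).comp (f := fun τ : ℝ => (ξ, τ)) (by fun_prop)).enorm)]
      gcongr
      exact hb' ξ
    · have e : ∀ ξ : Spc n, ‖heatW (ξ, 1)‖ₑ * (‖ξ‖ₑ * M' + M') =
          (2 * M') * ‖gradW (ξ, 1)‖ₑ + M' * ‖heatW (ξ, 1)‖ₑ := by
        intro ξ
        rw [grad_heat ξ one_pos, enorm_smul, enorm_mul]
        have : ‖(-(1 / (2 * 1)) : ℝ)‖ₑ = 2⁻¹ := by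
          rw [enorm_neg, Real.enorm_of_nonneg (by norm_num)]
          rw [mul_one, ENNReal.ofReal_div_of_pos (by norm_num)]
          simp
        rw [this]
        have h2 : (2 : ℝ≥0∞) * 2⁻¹ = 1 := ENNReal.mul_inv_cancel (by norm_num) (by norm_num)
        calc _ = M' * (1 * ‖heatW (ξ, 1)‖ₑ * ‖ξ‖ₑ) + M' * ‖heatW (ξ, 1)‖ₑ := by ring
          _ = _ := by rw [← h2]; ring
      simp_rw [e]
      have m3 := gradW_meas (n := n)
      rw [lintegral_add_left (by fun_prop), lintegral_const_mul _ (by fun_prop),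
        lintegral_const_mul _ (by fun_prop)]
      have g1 := grad_lint (n := n) 1
      have g2 := heatW_lint_le (n := n) 1
      have g1' : ∫⁻ x : Spc n, ‖gradW (x, 1)‖ₑ < ⊤ := g1.trans_lt (by finiteness)
      have g2' : ∫⁻ x : Spc n, ‖heatW (x, 1)‖ₑ < ⊤ := g2.trans_lt (by finiteness)
      finiteness
  have sw := integral_integral_swap (f := fun ξ τ => heatW (ξ, 1) * Fp φ y ξ τ) IF
  rw [← sw]
  have e2 : ∀ ξ : Spc n, ∫ τ in Ioi (0:ℝ), heatW (ξ, 1) * Fp φ y ξ τ = heatW (ξ, 1) * (- φ y) := by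
    intro ξ
    rw [integral_const_mul, (Fp_int H y ξ).2]
  simp_rw [e2]
  rw [integral_mul_const, heatW_int one_pos]
  ring
end rep

section conv
variable {n : ℕ}

/-- total variation -/
def tv (ν : SignedMeasure (Pt n)) : Measure (Pt n) :=
  ν.toJordanDecomposition.posPart + ν.toJordanDecomposition.negPart

instance (ν : SignedMeasure (Pt n)) : IsFiniteMeasure (tv ν) := by unfold tv; infer_instance

lemma sInt_enorm (ν : SignedMeasure (Pt n)) (K : Pt n → ℝ) : ‖sInt ν K‖ₑ ≤ ∫⁻ y, ‖K y‖ₑ ∂(tv ν) := by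
  unfold sInt tv
  rw [lintegral_add_measure]
  exact enorm_sub_le.trans (add_le_add (enorm_integral_le_lintegral_enorm _)
    (enorm_integral_le_lintegral_enorm _))

lemma sInt_sub (ν : SignedMeasure (Pt n)) {K K' : Pt n → ℝ} (h : Integrable K (tv ν))
    (h' : Integrable K' (tv ν)) : sInt ν K - sInt ν K' = sInt ν (fun y => K y - K' y) := by
  unfold tv at h h'
  rw [integrable_add_measure] at h h'
  unfold sInt
  rw [integral_sub h.1 h'.1, integral_sub h.2 h'.2]
  ring

lemma convW_meas (ν : SignedMeasure (Pt n)) : Measurable (convW ν) := by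
  have hm : StronglyMeasurable (fun z : Pt n × Pt n => heatW (z.1 - z.2)) := by
    apply Measurable.stronglyMeasurable
    have := heatW_meas (n := n)
    fun_prop
  unfold convW sInt
  exact (hm.integral_prod_right'.measurable).sub (hm.integral_prod_right'.measurable)

lemma heat_dbl (μ : Measure (Pt n)) [IsFiniteMeasure μ] (t : ℝ) :
    ∫⁻ x : Spc n, ∫⁻ y, ‖heatW ((x, t) - y)‖ₑ ∂μ ≤ μ univ := by
  have := heatW_meas (n := n)
  rw [lintegral_lintegral_swap (by fun_prop)]
  calc _ ≤ ∫⁻ y, 1 ∂μ := by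
        apply lintegral_mono
        intro y
        have : ∀ x : Spc n, ‖heatW ((x, t) - y)‖ₑ = (fun x => ‖heatW (x, t - y.2)‖ₑ) (x - y.1) :=
          fun x => rfl
        simp_rw [this]
        rw [lintegral_sub_right_eq_self (fun x : Spc n => ‖heatW (x, t - y.2)‖ₑ) y.1]
        exact heatW_lint_le _
    _ = _ := by simp

lemma conv_lint (ν : SignedMeasure (Pt n)) (t : ℝ) :
    ∫⁻ x : Spc n, ‖convW ν (x, t)‖ₑ ≤ tv ν univ :=
  (lintegral_mono fun _ => sInt_enorm ν _).trans (heat_dbl (tv ν) t)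

lemma heat_ae (μ : Measure (Pt n)) [IsFiniteMeasure μ] (t : ℝ) :
    ∀ᵐ x : Spc n, Integrable (fun y => heatW ((x, t) - y)) μ := by
  have hm := heatW_meas (n := n)
  have := ae_lt_top' (f := fun x : Spc n => ∫⁻ y, ‖heatW ((x, t) - y)‖ₑ ∂μ) (by
    apply Measurable.aemeasurable
    apply Measurable.lintegral_prod_right (f := fun (x : Spc n) (y : Pt n) => ‖heatW ((x, t) - y)‖ₑ)
    fun_prop) ((heat_dbl μ t).trans_lt (measure_lt_top _ _)).ne
  filter_upwards [this] with x hx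
  exact ⟨(by fun_prop : Measurable _).aestronglyMeasurable, hx⟩

lemma conv_diff (hn : 1 ≤ n) (ν : SignedMeasure (Pt n)) (s t : ℝ) :
    ∫⁻ x : Spc n, ‖convW ν (x, s) - convW ν (x, t)‖ₑ ≤
      ∫⁻ y, ENNReal.ofReal (2 * beta n (s - t) (t - y.2)) ∂(tv ν) := by
  have hm := heatW_meas (n := n)
  calc _ ≤ ∫⁻ x : Spc n, ∫⁻ y, ‖heatW ((x, s) - y) - heatW ((x, t) - y)‖ₑ ∂(tv ν) := by
        apply lintegral_mono_ae
        filter_upwards [heat_ae (tv ν) s, heat_ae (tv ν) t] with x h1 h2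
        unfold convW
        rw [sInt_sub ν h1 h2]
        exact sInt_enorm ν _
    _ ≤ _ := by
      rw [lintegral_lintegral_swap (by fun_prop)]
      apply lintegral_mono
      intro y
      have : ∀ x : Spc n, ‖heatW ((x, s) - y) - heatW ((x, t) - y)‖ₑ =
          (fun x => ‖heatW (x, s - y.2) - heatW (x, t - y.2)‖ₑ) (x - y.1) := fun x => rfl
      simp_rw [this]
      rw [lintegral_sub_right_eq_self
        (fun x : Spc n => ‖heatW (x, s - y.2) - heatW (x, t - y.2)‖ₑ) y.1]
      refine (heat_diff hn _ _).trans ?_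
      rw [show s - y.2 - (t - y.2) = s - t by ring]

theorem conv_triple (hn : 1 ≤ n) (ν : SignedMeasure (Pt n)) {b : ℝ → ℝ≥0∞} (hb : Measurable b) {B : ℝ≥0∞}
    (hB : B ≠ ⊤) (hbB : ∀ t, b t ≤ B) (hbi : ∫⁻ t, b t ≠ ⊤) :
    ∫⁻ z : (Spc n × ℝ) × ℝ, ‖(convW ν (z.1.1, z.2) - convW ν z.1) / |z.2 - z.1.2| ^ (3/2 : ℝ)‖ₑ * b z.1.2
      ∂((volume.prod volume).prod volume) < ⊤ := by
  have hm := convW_meas ν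
  have hbeta := beta_meas n
  have hk : ∀ a c : ℝ, ‖c / |a| ^ (3/2 : ℝ)‖ₑ = ‖c‖ₑ * ENNReal.ofReal (|a| ^ (-3/2 : ℝ)) := by
    intro a c
    rw [div_eq_mul_inv, enorm_mul, ← rpow_neg (abs_nonneg a),
      Real.enorm_of_nonneg (rpow_nonneg (abs_nonneg a) _), neg_div]
  simp_rw [hk]
  rw [lintegral_prod_symm' _ (by fun_prop)]
  calc _ = ∫⁻ s : ℝ, ∫⁻ t : ℝ, (∫⁻ x : Spc n, ‖convW ν (x, s) - convW ν (x, t)‖ₑ) *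
          (ENNReal.ofReal (|s - t| ^ (-3/2 : ℝ)) * b t) := by
        apply lintegral_congr
        intro s
        rw [lintegral_prod_symm' _ (by fun_prop)]
        apply lintegral_congr
        intro t
        simp only [mul_assoc]
        rw [lintegral_mul_const _ (by fun_prop)]
    _ ≤ ∫⁻ s : ℝ, ∫⁻ t : ℝ, (∫⁻ y, ENNReal.ofReal (2 * beta n (s - t) (t - y.2)) ∂(tv ν)) *
          (ENNReal.ofReal (|s - t| ^ (-3/2 : ℝ)) * b t) := by
        gcongr with s t
        exact conv_diff hn ν s t
    _ = ∫⁻ t : ℝ, ∫⁻ s : ℝ, ∫⁻ y, ENNReal.ofReal (2 * beta n (s - t) (t - y.2)) *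
          (ENNReal.ofReal (|s - t| ^ (-3/2 : ℝ)) * b t) ∂(tv ν) := by
        rw [lintegral_lintegral_swap]
        · apply lintegral_congr
          intro t
          apply lintegral_congr
          intro s
          rw [lintegral_mul_const _ (by fun_prop)]
        · apply Measurable.aemeasurable
          apply Measurable.mul _ (by fun_prop)
          apply Measurable.lintegral_prod_right
            (f := fun (z : ℝ × ℝ) (y : Pt n) => ENNReal.ofReal (2 * beta n (z.1 - z.2) (z.2 - y.2)))
          fun_prop
    _ = ∫⁻ t : ℝ, ∫⁻ y, (∫⁻ s : ℝ, ENNReal.ofReal (2 * beta n (s - t) (t - y.2)) *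
          (ENNReal.ofReal (|s - t| ^ (-3/2 : ℝ)) * b t)) ∂(tv ν) := by
        apply lintegral_congr
        intro t
        rw [lintegral_lintegral_swap (by fun_prop)]
    _ = ∫⁻ y, (∫⁻ t : ℝ, ∫⁻ s : ℝ, ENNReal.ofReal (2 * beta n (s - t) (t - y.2)) *
          (ENNReal.ofReal (|s - t| ^ (-3/2 : ℝ)) * b t)) ∂(tv ν) := by
        rw [lintegral_lintegral_swap]
        apply Measurable.aemeasurable
        apply Measurable.lintegral_prod_right (f := fun (z : ℝ × Pt n) (s : ℝ) =>
            ENNReal.ofReal (2 * beta n (s - z.1) (z.1 - z.2.2)) *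
            (ENNReal.ofReal (|s - z.1| ^ (-3/2 : ℝ)) * b z.1))
        fun_prop
    _ ≤ ∫⁻ y, ENNReal.ofReal (8 * n + 8) * (ENNReal.ofReal (4 * √1) * B +
          ENNReal.ofReal ((1:ℝ) ^ (-1/2 : ℝ)) * ∫⁻ t, b t) ∂(tv ν) := by
        apply lintegral_mono
        intro y
        beta_reduce
        refine le_trans ?_ (mul_le_mul_right (half_conv b hb B hbB one_pos y.2) _)
        rw [← lintegral_const_mul _ (by fun_prop)]
        apply lintegral_mono_ae
        have hne : ∀ᵐ t : ℝ, t ≠ y.2 := by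
          rw [ae_iff]; simp
        filter_upwards [hne] with t ht
        simp only [← mul_assoc]
        rw [lintegral_mul_const _ (by fun_prop)]
        gcongr
        rw [lintegral_sub_right_eq_self (fun a => ENNReal.ofReal (2 * beta n a (t - y.2)) *
          ENNReal.ofReal (|a| ^ (-3/2 : ℝ))) t]
        exact beta_lint (sub_ne_zero.2 ht)
    _ < ⊤ := by
        rw [lintegral_const]
        finiteness

lemma slab_ae {E : Type*} [NormedAddCommGroup E] [MeasurableSpace E] [BorelSpace E]
    [SecondCountableTopology E] {K : Pt n → E} (hK : Measurable K)
    (μ : Measure (Pt n)) [IsFiniteMeasure μ] {T L : ℝ} {M : ℝ≥0∞} (hM : M < ⊤)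
    (h : ∀ y, ∫⁻ p, ‖K (p - y)‖ₑ * slab T L 1 p.2 ≤ M) :
    ∀ᵐ p : Pt n, p.2 ∈ Icc T (T + L) → Integrable (fun y => K (p - y)) μ := by
  have hs := slab_meas T L 1
  have h1 : ∫⁻ p : Pt n, ∫⁻ y, ‖K (p - y)‖ₑ * slab T L 1 p.2 ∂μ ≠ ⊤ := by
    rw [lintegral_lintegral_swap (by fun_prop)]
    refine (lt_of_le_of_lt (lintegral_mono h) ?_).ne
    rw [lintegral_const]
    finiteness
  have := ae_lt_top' (f := fun p : Pt n => ∫⁻ y, ‖K (p - y)‖ₑ * slab T L 1 p.2 ∂μ) (by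
    apply Measurable.aemeasurable
    apply Measurable.lintegral_prod_right (f := fun (p y : Pt n) => ‖K (p - y)‖ₑ * slab T L 1 p.2)
    fun_prop) h1
  filter_upwards [this] with p hp hpt
  refine ⟨(by fun_prop : Measurable _).aestronglyMeasurable, ?_⟩
  unfold HasFiniteIntegral
  have e : slab T L 1 p.2 = 1 := by
    unfold slab; rw [indicator_of_mem hpt]; simp
  simpa [e] using hp

lemma rep_meas {φ : Pt n → ℝ} {A A' T L : ℝ} (H : Tst φ A A' T L) (μ : Measure (Pt n))
    [IsFiniteMeasure μ] :
    Integrable (fun p => ∫ y, Kr φ y p ∂μ) ∧ ∫ y, φ y ∂μ = ∫ p, ∫ y, Kr φ y p ∂μ ∧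
    ∀ᵐ p, ∫ y, Kr φ y p ∂μ = dx φ p (∫ y, gradW (p - y) ∂μ) - (∫ y, heatW (p - y) ∂μ) * dt φ p := by
  obtain ⟨M, hM, hb⟩ := Kr_lint H
  have I : Integrable (fun z : Pt n × Pt n => Kr φ z.1 z.2) (μ.prod volume) := by
    refine int_prod_of_bound (Kr_meas H.cd) (fun _ => M) hb ?_
    rw [lintegral_const]
    finiteness
  refine ⟨I.integral_prod_right, ?_, ?_⟩
  · rw [← integral_integral_swap (f := fun y p => Kr φ y p) I]
    simp_rw [Kr_rep H]
  · have a1 := slab_ae (gradW_meas (n := n)) μ (T := T) (L := L) (M := ENNReal.ofReal ((2 : ℝ) ^ ((n : ℝ) / 2)) *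
      (ENNReal.ofReal (4 * √1) * ENNReal.ofReal 1 + ENNReal.ofReal ((1:ℝ) ^ (-1/2 : ℝ)) *
        ∫⁻ t, slab T L 1 t)) (by rw [slab_int]; finiteness)
      (fun y => slab_grad y (slab_meas T L 1) (slab_le T L 1))
    have a2 := slab_ae (heatW_meas (n := n)) μ (T := T) (L := L) (M := ∫⁻ t, slab T L 1 t)
      (by rw [slab_int]; finiteness) (fun y => slab_heat y (slab_meas T L 1))
    filter_upwards [a1, a2] with p h1 h2
    by_cases hp : p.2 ∈ Icc T (T + L)
    · unfold Kr
      rw [integral_sub, ContinuousLinearMap.integral_comp_comm _ (h1 hp), integral_mul_const]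
      · exact (dx φ p).integrable_comp (h1 hp)
      · exact (h2 hp).mul_const _
    · unfold Kr
      rw [H.dxs p hp, H.dts p hp]
      simp

theorem rep_signed {φ : Pt n → ℝ} {A A' T L : ℝ} (H : Tst φ A A' T L) (ν : SignedMeasure (Pt n)) :
    Integrable (fun p => dx φ p (convGradW ν p) - convW ν p * dt φ p) ∧
    sInt ν φ = ∫ p, (dx φ p (convGradW ν p) - convW ν p * dt φ p) := by
  obtain ⟨i1, e1, a1⟩ := rep_meas H ν.toJordanDecomposition.posPart
  obtain ⟨i2, e2, a2⟩ := rep_meas H ν.toJordanDecomposition.negPart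
  have ae : (fun p => (∫ y, Kr φ y p ∂ν.toJordanDecomposition.posPart)
      - ∫ y, Kr φ y p ∂ν.toJordanDecomposition.negPart) =ᵐ[volume]
      fun p => dx φ p (convGradW ν p) - convW ν p * dt φ p := by
    filter_upwards [a1, a2] with p h1 h2
    rw [h1, h2]
    unfold convGradW convW vInt sInt
    rw [map_sub]
    ring
  refine ⟨(i1.sub i2).congr ae, ?_⟩
  rw [← integral_congr_ae ae, integral_sub i1 i2, sInt, e1, e2]
end conv

section bmo
variable {n : ℕ}

def Qx (c : Fin n → ℝ) (l : ℝ) : Set (Spc n) := {x | ∀ i, x i ∈ Icc (c i) (c i + l)}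

def St (c : Fin n → ℝ) (l T L : ℝ) : Set (Pt n) := Qx c l ×ˢ Icc T (T + L)

lemma Qx_eq (c : Fin n → ℝ) (l : ℝ) :
    Qx c l = (@WithLp.ofLp 2 (Fin n → ℝ)) ⁻¹' (Set.pi univ fun i => Icc (c i) (c i + l)) := by
  ext x
  simp only [Qx, mem_preimage, Set.mem_pi, mem_univ, true_imp_iff, mem_ofPred_eq]

lemma Qx_meas (c : Fin n → ℝ) (l : ℝ) : MeasurableSet (Qx c l) := by
  rw [Qx_eq]
  exact (PiLp.volume_preserving_ofLp (Fin n)).measurable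
    (MeasurableSet.univ_pi fun i => measurableSet_Icc)

lemma Qx_vol (c : Fin n → ℝ) {l : ℝ} (hl : 0 ≤ l) : volume (Qx c l) = ENNReal.ofReal (l ^ n) := by
  rw [Qx_eq, (PiLp.volume_preserving_ofLp (Fin n)).measure_preimage
    (MeasurableSet.univ_pi fun i => measurableSet_Icc).nullMeasurableSet, volume_pi_pi]
  simp [ENNReal.ofReal_pow hl]

lemma St_meas (c : Fin n → ℝ) (l T L : ℝ) : MeasurableSet (St c l T L) :=
  (Qx_meas c l).prod measurableSet_Icc

lemma St_vol (c : Fin n → ℝ) {l : ℝ} (hl : 0 ≤ l) (T L : ℝ) :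
    volume (St c l T L) = ENNReal.ofReal (l ^ n * L) := by
  rw [St, Measure.volume_eq_prod, Measure.prod_prod, Qx_vol c hl, Real.volume_Icc, add_sub_cancel_left,
    ENNReal.ofReal_mul (by positivity)]

lemma toSet_eq (Q : PCube n) : Q.toSet = St Q.corner Q.len Q.time (Q.len ^ 2) := by
  ext p
  simp only [PCube.toSet, St, Qx, mem_prod, mem_ofPred_eq]

structure BM (g : Pt n → ℝ) : Prop where
  meas : Measurable g
  int : ∀ T L : ℝ, IntegrableOn g {p : Pt n | p.2 ∈ Icc T (T + L)}
  bmo : ParabBMOLe g 1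

/-- mean over the standard cube -/
def mn (g : Pt n → ℝ) (c : Fin n → ℝ) (l T : ℝ) : ℝ := ⨍ p in St c l T (l ^ 2), g p

lemma BM.int_St {g : Pt n → ℝ} (H : BM g) (c : Fin n → ℝ) (l T L : ℝ) : IntegrableOn g (St c l T L) :=
  (H.int T L).mono_set fun _ hp => hp.2

lemma BM.osc {g : Pt n → ℝ} (H : BM g) (c : Fin n → ℝ) {l : ℝ} (hl : 0 < l) (T : ℝ) :
    ∫⁻ p in St c l T (l ^ 2), ‖g p - mn g c l T‖ₑ ≤ ENNReal.ofReal (l ^ n * l ^ 2) := by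
  have h := H.bmo ⟨c, T, l, hl⟩
  rw [toSet_eq] at h
  simp only at h
  change ⨍ p in St c l T (l ^ 2), |g p - mn g c l T| ≤ 1 at h
  have hv := St_vol c hl.le T (l ^ 2)
  have hpos : 0 < l ^ n * l ^ 2 := by positivity
  rw [setAverage_eq, measureReal_def, hv, ENNReal.toReal_ofReal hpos.le, smul_eq_mul,
    inv_mul_le_iff₀ hpos, mul_one] at h
  have hI : IntegrableOn (fun p => g p - mn g c l T) (St c l T (l ^ 2)) := by
    apply (H.int_St c l T _).sub
    exact integrableOn_const (by rw [hv]; exact ENNReal.ofReal_ne_top)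
  rw [← ofReal_integral_norm_eq_lintegral_enorm hI]
  exact ENNReal.ofReal_le_ofReal h

/-- doubling constant -/
def Nd (n : ℕ) : ℝ := 2 ^ (n + 2)

lemma Nd_nonneg (n : ℕ) : 0 ≤ Nd n := by unfold Nd; positivity

lemma BM.mean_diff {g : Pt n → ℝ} (H : BM g) (c : Fin n → ℝ) {l : ℝ} (hl : 0 < l) (T T' : ℝ)
    (h : Icc T (T + l ^ 2) ⊆ Icc T' (T' + (2 * l) ^ 2)) :
    |mn g c l T - mn g c (2 * l) T'| ≤ Nd n := by
  have hpos : 0 < l ^ n * l ^ 2 := by positivity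
  have hsub : St c l T (l ^ 2) ⊆ St c (2 * l) T' ((2 * l) ^ 2) := by
    apply prod_mono _ h
    intro x hx i
    exact ⟨(hx i).1, (hx i).2.trans (by linarith)⟩
  have hv := St_vol c hl.le T (l ^ 2)
  have hI := H.int_St c l T (l ^ 2)
  set m' := mn g c (2 * l) T'
  have hIc : IntegrableOn (fun _ : Pt n => m') (St c l T (l ^ 2)) := by
    exact integrableOn_const (by rw [hv]; exact ENNReal.ofReal_ne_top)
  have e1 : (l ^ n * l ^ 2) * (mn g c l T - m') = ∫ p in St c l T (l ^ 2), (g p - m') := by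
    rw [integral_sub hI hIc, setIntegral_const, measureReal_def, hv, ENNReal.toReal_ofReal hpos.le,
      mn, setAverage_eq, measureReal_def, hv, ENNReal.toReal_ofReal hpos.le, smul_eq_mul, smul_eq_mul,
      mul_sub, ← mul_assoc, mul_inv_cancel₀ hpos.ne', one_mul]
  have e2 : ‖∫ p in St c l T (l ^ 2), (g p - m')‖ₑ ≤ ENNReal.ofReal ((2 * l) ^ n * (2 * l) ^ 2) :=
    (enorm_integral_le_lintegral_enorm _).trans ((lintegral_mono_set hsub).trans (H.osc c (by positivity) T'))
  rw [← e1, ← ofReal_norm, ENNReal.ofReal_le_ofReal_iff (by positivity), norm_mul,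
    Real.norm_of_nonneg hpos.le, Real.norm_eq_abs] at e2
  have e3 : (2 * l) ^ n * (2 * l) ^ 2 = (l ^ n * l ^ 2) * Nd n := by
    unfold Nd; rw [mul_pow, mul_pow, pow_add]; ring
  rw [e3] at e2
  exact le_of_mul_le_mul_left e2 hpos

lemma E_shift {g : Pt n → ℝ} (hg : Measurable g) (S : Set (Pt n)) (a b : ℝ) {D : ℝ} (hD : |a - b| ≤ D) :
    ∫⁻ p in S, ‖g p - b‖ₑ ≤ (∫⁻ p in S, ‖g p - a‖ₑ) + ENNReal.ofReal D * volume S := by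
  rw [← setLIntegral_const, ← lintegral_add_right _ measurable_const]
  apply lintegral_mono
  intro p
  beta_reduce
  rw [show g p - b = (g p - a) + (a - b) by ring]
  refine (enorm_add_le _ _).trans ?_
  gcongr
  rw [← ofReal_norm]
  exact ENNReal.ofReal_le_ofReal hD

lemma BM.tower {g : Pt n → ℝ} (H : BM g) (c : Fin n → ℝ) {l : ℝ} (hl : 0 < l) (k : ℕ) :
    ∀ T : ℝ, ∫⁻ p in St c l T (4 ^ k * l ^ 2), ‖g p - mn g c (2 ^ k * l) T‖ₑ ≤
      ENNReal.ofReal (4 ^ k * l ^ (n + 2) * (1 + k * Nd n)) := by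
  have hN := Nd_nonneg n
  induction k with
  | zero =>
    intro T
    have := H.osc c hl T
    simp only [pow_zero, one_mul, Nat.cast_zero, zero_mul, add_zero, mul_one, pow_add]
    exact this
  | succ k ih =>
    intro T
    set a := 4 ^ k * l ^ 2 with ha
    have ha0 : 0 < a := by positivity
    set m' := mn g c (2 ^ (k + 1) * l) T with hm'
    have piece : ∀ j : ℝ, 0 ≤ j → j ≤ 3 → ∫⁻ p in St c l (T + j * a) a, ‖g p - m'‖ₑ ≤
        ENNReal.ofReal (4 ^ k * l ^ (n + 2) * (1 + (k + 1) * Nd n)) := by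
      intro j hj0 hj3
      have hd : |mn g c (2 ^ k * l) (T + j * a) - m'| ≤ Nd n := by
        rw [hm', show (2:ℝ) ^ (k + 1) * l = 2 * (2 ^ k * l) by ring]
        apply H.mean_diff c (by positivity)
        have e1 : (2 ^ k * l) ^ 2 = a := by
          rw [mul_pow, ← pow_mul, mul_comm k 2, pow_mul]; norm_num [ha]
        have e2 : (2 * (2 ^ k * l)) ^ 2 = 4 * a := by
          rw [mul_pow, e1]; norm_num
        rw [e1, e2]
        apply Icc_subset_Icc
        · nlinarith
        · nlinarith
      refine (E_shift H.meas _ _ _ hd).trans ?_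
      refine (add_le_add (ih (T + j * a)) le_rfl).trans ?_
      rw [St_vol c hl.le, ← ENNReal.ofReal_mul hN, ← ENNReal.ofReal_add (by positivity) (by positivity)]
      apply ENNReal.ofReal_le_ofReal
      rw [ha]
      apply le_of_eq
      ring
    have hcov : St c l T (4 ^ (k + 1) * l ^ 2) ⊆
        ((St c l (T + 0 * a) a ∪ St c l (T + 1 * a) a) ∪ St c l (T + 2 * a) a) ∪ St c l (T + 3 * a) a := by
      rintro p ⟨h1, h2⟩
      have e : 4 ^ (k + 1) * l ^ 2 = 4 * a := by rw [ha]; ring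
      rw [e, mem_Icc] at h2
      simp only [St, mem_union, mem_prod, h1, true_and, mem_Icc]
      by_cases c1 : p.2 ≤ T + a
      · left; left; left; constructor <;> linarith
      · by_cases c2 : p.2 ≤ T + 2 * a
        · left; left; right; constructor <;> linarith
        · by_cases c3 : p.2 ≤ T + 3 * a
          · left; right; constructor <;> linarith
          · right; constructor <;> linarith
    refine (lintegral_mono_set hcov).trans ?_
    have hp : 0 ≤ 4 ^ k * l ^ (n + 2) * (1 + (k + 1) * Nd n) := by positivity
    calc _ ≤ ((_ + _) + _) + _ := (lintegral_union_le _ _ _).trans (add_le_add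
            ((lintegral_union_le _ _ _).trans (add_le_add (lintegral_union_le _ _ _) le_rfl)) le_rfl)
      _ ≤ _ := add_le_add (add_le_add (add_le_add (piece 0 le_rfl (by norm_num)) (piece 1 (by norm_num) (by norm_num)))
          (piece 2 (by norm_num) (by norm_num))) (piece 3 (by norm_num) le_rfl)
      _ = _ := by
        rw [← ENNReal.ofReal_add hp hp, ← ENNReal.ofReal_add (by positivity) hp,
          ← ENNReal.ofReal_add (by positivity) hp]
        congr 1
        push_cast
        ring

lemma BM.chain {g : Pt n → ℝ} (H : BM g) (c : Fin n → ℝ) {l : ℝ} (hl : 0 < l) (T : ℝ) (k : ℕ) :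
    |mn g c (2 ^ k * l) T - mn g c l T| ≤ k * Nd n := by
  induction k with
  | zero => simp
  | succ k ih =>
    have h := H.mean_diff c (l := 2 ^ k * l) (by positivity) T T (by
      apply Icc_subset_Icc le_rfl
      have : 0 ≤ (2 ^ k * l) ^ 2 := by positivity
      nlinarith)
    rw [show (2:ℝ) ^ (k + 1) * l = 2 * (2 ^ k * l) by ring]
    rw [abs_sub_comm] at h
    have := abs_sub_le (mn g c (2 * (2 ^ k * l)) T) (mn g c (2 ^ k * l) T) (mn g c l T)
    push_cast
    linarith

lemma BM.big {g : Pt n → ℝ} (H : BM g) (c : Fin n → ℝ) {l : ℝ} (hl : 0 < l) (T : ℝ) (k : ℕ) :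
    ∫⁻ p in St c l (T - 4 ^ k * l ^ 2) (4 ^ (k + 1) * l ^ 2), ‖g p - mn g c l T‖ₑ ≤
      ENNReal.ofReal (4 ^ (k + 1) * l ^ (n + 2) * (1 + 2 * (k + 1) * Nd n)) := by
  have hN := Nd_nonneg n
  have h1 := H.tower c hl (k + 1) (T - 4 ^ k * l ^ 2)
  have h2 := H.chain c hl T k
  have h3 := H.mean_diff c (l := 2 ^ k * l) (by positivity) T (T - 4 ^ k * l ^ 2) (by
    have e1 : (2 ^ k * l) ^ 2 = 4 ^ k * l ^ 2 := by
      rw [mul_pow, ← pow_mul, mul_comm k 2, pow_mul]; norm_num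
    have : 0 ≤ (4:ℝ) ^ k * l ^ 2 := by positivity
    rw [mul_pow 2, e1]
    apply Icc_subset_Icc <;> linarith)
  have e : (2:ℝ) * (2 ^ k * l) = 2 ^ (k + 1) * l := by ring
  rw [e, abs_sub_comm] at h3
  have h4 : |mn g c (2 ^ (k + 1) * l) (T - 4 ^ k * l ^ 2) - mn g c l T| ≤ (k + 1) * Nd n := by
    have := abs_sub_le (mn g c (2 ^ (k + 1) * l) (T - 4 ^ k * l ^ 2)) (mn g c (2 ^ k * l) T) (mn g c l T)
    linarith
  refine (E_shift H.meas _ _ _ h4).trans ?_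
  refine (add_le_add h1 le_rfl).trans ?_
  rw [St_vol c hl.le, ← ENNReal.ofReal_mul (by positivity), ← ENNReal.ofReal_add (by positivity) (by positivity)]
  apply ENNReal.ofReal_le_ofReal
  apply le_of_eq
  push_cast
  ring

lemma bnd_tsum {l T : ℝ} (hl : 0 < l) (t : ℝ) :
    ENNReal.ofReal (bnd (1 / l ^ 2) T (l ^ 2) t) ≤ ∑' k : ℕ, ENNReal.ofReal (16 * (1/8) ^ k / l) *
      (Icc (T - 4 ^ k * l ^ 2) (T - 4 ^ k * l ^ 2 + 4 ^ (k + 1) * l ^ 2)).indicator (fun _ => (1:ℝ≥0∞)) t := by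
  classical
  have hl2 : 0 < l ^ 2 := by positivity
  have hJ : ∃ k : ℕ, t ∈ Icc (T - 4 ^ k * l ^ 2) (T - 4 ^ k * l ^ 2 + 4 ^ (k + 1) * l ^ 2) := by
    obtain ⟨k, hk⟩ := pow_unbounded_of_one_lt (|t - T| / l ^ 2) (by norm_num : (1:ℝ) < 4)
    rw [div_lt_iff₀ hl2] at hk
    refine ⟨k, ?_, ?_⟩
    · have := neg_abs_le (t - T); linarith
    · have := le_abs_self (t - T)
      have h0 : 0 ≤ (4:ℝ) ^ k * l ^ 2 := by positivity
      rw [pow_succ 4 k]; linarith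
  set k := Nat.find hJ with hkdef
  have hk := Nat.find_spec hJ
  rw [← hkdef] at hk
  refine le_trans ?_ (ENNReal.le_tsum k)
  rw [indicator_of_mem hk, mul_one]
  apply ENNReal.ofReal_le_ofReal
  rcases Nat.eq_zero_or_pos k with h0 | h0
  · rw [h0]
    have := bnd_le (B := 1 / l ^ 2) (T := T) (L := l ^ 2) (by positivity) hl2 t
    refine this.trans ?_
    rw [Real.sqrt_sq hl.le]
    have : 5 * (1 / l ^ 2) * l = 5 / l := by field_simp
    rw [this, pow_zero, mul_one]
    gcongr
    norm_num
  · obtain ⟨j, hj⟩ := Nat.exists_eq_succ_of_ne_zero h0.ne'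
    have hnj : t ∉ Icc (T - 4 ^ j * l ^ 2) (T - 4 ^ j * l ^ 2 + 4 ^ (j + 1) * l ^ 2) :=
      Nat.find_min hJ (by rw [← hkdef, hj]; exact Nat.lt_succ_self j)
    have hj4 : (1:ℝ) ≤ 4 ^ j := one_le_pow₀ (by norm_num)
    have ef : T - 4 ^ j * l ^ 2 + 4 ^ (j + 1) * l ^ 2 = T + 3 * (4 ^ j * l ^ 2) := by rw [pow_succ]; ring
    rw [ef] at hnj
    have hfar := bnd_far (by positivity) hnj
    have hn0 : t ∉ Icc (T - l ^ 2) (T + 3 * l ^ 2) := by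
      intro h
      apply hnj
      constructor
      · nlinarith [h.1]
      · nlinarith [h.2]
    unfold bnd
    rw [if_neg hn0]
    have h3 : |t - T| ^ (-3/2 : ℝ) ≤ (4 ^ j * l ^ 2) ^ (-3/2 : ℝ) :=
      rpow_le_rpow_of_nonpos (by positivity) hfar.le (by norm_num)
    have h4 : (4 ^ j * l ^ 2 : ℝ) ^ (-3/2 : ℝ) = (1/8) ^ j / l ^ 3 := by
      rw [rpow_n3 (by positivity)]
      have : √((4:ℝ) ^ j * l ^ 2) = 2 ^ j * l := by
        rw [show (4:ℝ) ^ j * l ^ 2 = (2 ^ j * l) ^ 2 by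
          rw [mul_pow, ← pow_mul, mul_comm j 2, pow_mul]; norm_num]
        exact Real.sqrt_sq (by positivity)
      rw [this, one_div_pow, show (8:ℝ) = 4 * 2 by norm_num, mul_pow]
      field_simp
    calc _ ≤ 2 * (1 / l ^ 2) * (l ^ 2) ^ 2 * ((1/8) ^ j / l ^ 3) := by rw [← h4]; gcongr
      _ = 16 * (1/8) ^ k / l := by
        rw [hj, Nat.succ_eq_add_one]
        field_simp
        ring

def Sn (n : ℕ) : ℝ := ∑' k : ℕ, (64 * ((1/2 : ℝ) ^ k * (1 + 2 * (k + 1) * Nd n)))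

lemma Sn_summable (n : ℕ) : Summable fun k : ℕ => (64 * ((1/2 : ℝ) ^ k * (1 + 2 * (k + 1) * Nd n))) := by
  apply Summable.mul_left
  have h0 : Summable fun k : ℕ => (1/2 : ℝ) ^ k := summable_geometric_of_lt_one (by norm_num) (by norm_num)
  have h1 : Summable fun k : ℕ => (k : ℝ) ^ 1 * (1/2 : ℝ) ^ k :=
    summable_pow_mul_geometric_of_norm_lt_one 1 (by norm_num)
  refine ((h0.mul_right (1 + 2 * Nd n)).add (h1.mul_right (2 * Nd n))).congr fun k => ?_
  ring

theorem BM.pair {g : Pt n → ℝ} (H : BM g) (c : Fin n → ℝ) {l : ℝ} (hl : 0 < l) (T : ℝ) :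
    ∫⁻ p, ‖g p - mn g c l T‖ₑ * ((Qx c l).indicator (fun _ => (1:ℝ≥0∞)) p.1 *
      ENNReal.ofReal (bnd (1 / l ^ 2) T (l ^ 2) p.2)) ≤ ENNReal.ofReal (Sn n * l ^ (n + 1)) := by
  have hN := Nd_nonneg n
  have hg := H.meas
  calc _ ≤ ∫⁻ p, ∑' k : ℕ, ENNReal.ofReal (16 * (1/8) ^ k / l) *
        (St c l (T - 4 ^ k * l ^ 2) (4 ^ (k + 1) * l ^ 2)).indicator (fun p => ‖g p - mn g c l T‖ₑ) p := by
        apply lintegral_mono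
        intro p
        beta_reduce
        by_cases hp : p.1 ∈ Qx c l
        · rw [indicator_of_mem hp, one_mul]
          refine (mul_le_mul_right (bnd_tsum hl p.2) _).trans ?_
          rw [← ENNReal.tsum_mul_left]
          apply ENNReal.tsum_le_tsum
          intro k
          by_cases hk : p.2 ∈ Icc (T - 4 ^ k * l ^ 2) (T - 4 ^ k * l ^ 2 + 4 ^ (k + 1) * l ^ 2)
          · rw [indicator_of_mem hk, indicator_of_mem (show p ∈ St _ _ _ _ from ⟨hp, hk⟩), mul_one, mul_comm]
          · rw [indicator_of_notMem hk]; simp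
        · rw [indicator_of_notMem hp]; simp
    _ = ∑' k : ℕ, ENNReal.ofReal (16 * (1/8) ^ k / l) *
        ∫⁻ p in St c l (T - 4 ^ k * l ^ 2) (4 ^ (k + 1) * l ^ 2), ‖g p - mn g c l T‖ₑ := by
        rw [lintegral_tsum]
        · congr 1
          funext k
          rw [lintegral_const_mul _ (Measurable.indicator (by fun_prop) (St_meas _ _ _ _)),
            lintegral_indicator (St_meas _ _ _ _)]
        · intro k
          exact (Measurable.const_mul (Measurable.indicator (by fun_prop) (St_meas _ _ _ _)) _).aemeasurable
    _ ≤ ∑' k : ℕ, ENNReal.ofReal (64 * ((1/2 : ℝ) ^ k * (1 + 2 * (k + 1) * Nd n)) * l ^ (n + 1)) := by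
        apply ENNReal.tsum_le_tsum
        intro k
        refine (mul_le_mul_right (H.big c hl T k) _).trans ?_
        rw [← ENNReal.ofReal_mul (by positivity)]
        apply ENNReal.ofReal_le_ofReal
        apply le_of_eq
        have e : (1/2 : ℝ) ^ k = (1/8) ^ k * 4 ^ k := by rw [← mul_pow]; norm_num
        rw [e, pow_succ 4, pow_succ l (n + 1)]
        field_simp
        try ring
    _ = _ := by
        rw [Sn, ← tsum_mul_right, ENNReal.ofReal_tsum_of_nonneg _ ((Sn_summable n).mul_right _)]
        intro k
        positivity
end bmo

section final
variable {n : ℕ}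

lemma halfT_meas {f : Pt n → ℝ} (hf : Measurable f) : Measurable (halfT f) := by
  have : StronglyMeasurable (fun z : Pt n × ℝ => (f (z.1.1, z.2) - f z.1) / |z.2 - z.1.2| ^ (3 / 2 : ℝ)) := by
    apply Measurable.stronglyMeasurable
    fun_prop
  exact this.integral_prod_right'.measurable

lemma halfT_w (hn : 1 ≤ n) (ν : SignedMeasure (Pt n)) {b : ℝ → ℝ≥0∞} (hb : Measurable b) {B : ℝ≥0∞}
    (hB : B ≠ ⊤) (hbB : ∀ t, b t ≤ B) (hbi : ∫⁻ t, b t ≠ ⊤) :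
    ∫⁻ p, ‖halfT (convW ν) p‖ₑ * b p.2 < ⊤ := by
  have hm := convW_meas ν
  refine lt_of_le_of_lt ?_ (conv_triple hn ν hb hB hbB hbi)
  rw [lintegral_prod _ (by fun_prop)]
  rw [← Measure.volume_eq_prod]
  apply lintegral_mono
  intro p
  show _ ≤ ∫⁻ y : ℝ, ‖(convW ν (p.1, y) - convW ν p) / |y - p.2| ^ (3/2 : ℝ)‖ₑ * b p.2
  rw [lintegral_mul_const _ (by fun_prop)]
  exact mul_le_mul_left (enorm_integral_le_lintegral_enorm _) _

lemma halfT_BM (hn : 1 ≤ n) (ν : SignedMeasure (Pt n)) (h : ParabBMOLe (halfT (convW ν)) 1) :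
    BM (halfT (convW ν)) := by
  have hg := halfT_meas (convW_meas ν)
  refine ⟨hg, fun T L => ?_, h⟩
  refine ⟨hg.aestronglyMeasurable, ?_⟩
  have hS : MeasurableSet {p : Pt n | p.2 ∈ Icc T (T + L)} := measurable_snd measurableSet_Icc
  have := halfT_w hn ν (slab_meas T L 1) ENNReal.ofReal_ne_top (slab_le T L 1)
    (by rw [slab_int]; finiteness)
  refine lt_of_le_of_lt ?_ this
  rw [← lintegral_indicator hS]
  apply lintegral_mono
  intro p
  beta_reduce
  by_cases hp : p.2 ∈ Icc T (T + L)
  · rw [indicator_of_mem (show p ∈ {p : Pt n | p.2 ∈ Icc T (T + L)} from hp), slab, indicator_of_mem hp]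
    simp
  · rw [indicator_of_notMem (show p ∉ {p : Pt n | p.2 ∈ Icc T (T + L)} from hp)]
    exact zero_le

lemma adm_zero {φ : Pt n → ℝ} {Q : PCube n} (h : Admissible φ Q) {p : Pt n} (hp : p ∉ Q.toSet) :
    φ p = 0 ∧ dx φ p = 0 ∧ dt φ p = 0 := by
  have hp' : p ∉ tsupport φ := fun h' => hp (h.2.1 h')
  have h1 : φ =ᶠ[𝓝 p] 0 := notMem_tsupport_iff_eventuallyEq.1 hp'
  have hf : fderiv ℝ φ p = 0 := by
    rw [h1.fderiv_eq]; simp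
  have cd : ContDiff ℝ 1 φ := h.1.of_le (by norm_num)
  refine ⟨h1.eq_of_nhds, ?_, ?_⟩
  · rw [dx_eq cd, hf]; simp
  · rw [dt_eq cd, hf]; simp

lemma adm_Tst {φ : Pt n → ℝ} {Q : PCube n} (h : Admissible φ Q) :
    Tst φ (1 / Q.len ^ 2) (1 / Q.len) Q.time (Q.len ^ 2) where
  cd := h.1.of_le (by norm_num)
  supp p hp := (adm_zero h (fun h' => hp h'.2)).1
  dxb := h.2.2.1
  dxs p hp := (adm_zero h (fun h' => hp h'.2)).2.1
  dtb p := (le_add_of_nonneg_left (abs_nonneg _)).trans (h.2.2.2 p)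
  dts p hp := (adm_zero h (fun h' => hp h'.2)).2.2

lemma adm_nice {φ : Pt n → ℝ} {Q : PCube n} (h : Admissible φ Q) (x : Spc n) :
    Nice (fun s => dt φ (x, s)) (1 / Q.len ^ 2) Q.time (Q.len ^ 2) ∧
    (∫ s, dt φ (x, s) = 0) ∧ ∫ t, pot (fun s => dt φ (x, s)) t = 0 := by
  have H := adm_Tst h
  have hl := Q.len_pos
  have hc : Continuous (dt φ) := dt_cont H.cd
  have cd : ContDiff ℝ 1 (fun s => φ (x, s)) := H.cd.comp (contDiff_const.prodMk contDiff_id)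
  have e : (fun s => dt φ (x, s)) = deriv (fun s => φ (x, s)) := rfl
  have N : Nice (fun s => dt φ (x, s)) (1 / Q.len ^ 2) Q.time (Q.len ^ 2) :=
    ⟨(by fun_prop : Continuous _).measurable, fun s => H.dtb (x, s), fun s hs => H.dts (x, s) hs,
      by positivity, by positivity⟩
  have hcs : HasCompactSupport (fun s => φ (x, s)) :=
    HasCompactSupport.intro isCompact_Icc (fun s hs => H.supp (x, s) hs)
  refine ⟨N, ?_, ?_⟩
  · exact integral_eq_zero_of_hasDerivAt_of_integrable (f := fun s => φ (x, s))
      (fun s => (cd.differentiable one_ne_zero s).hasDerivAt) N.integrable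
      (cd.continuous.integrable_of_hasCompactSupport hcs)
  · obtain ⟨C, hC⟩ := hcs.exists_bound_of_continuous cd.continuous
    rw [e]
    apply pot_mean_zero (B := C) (T := Q.time) (L := Q.len ^ 2) cd _ N
    exact ⟨cd.continuous.measurable, hC, fun s hs => H.supp (x, s) hs, by positivity,
      (norm_nonneg _).trans (hC 0)⟩

lemma Sn_nonneg (n : ℕ) : 0 ≤ Sn n := by
  have hN := Nd_nonneg n
  exact tsum_nonneg fun k => by positivity

lemma dt_term (hn : 1 ≤ n) (ν : SignedMeasure (Pt n)) (hb : ParabBMOLe (halfT (convW ν)) 1)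
    {φ : Pt n → ℝ} {Q : PCube n} (h : Admissible φ Q) :
    |cE| * |∫ p, convW ν p * dt φ p| ≤ Sn n * Q.len ^ (n + 1) := by
  have H := adm_Tst h
  have hl := Q.len_pos
  have hl2 : 0 < Q.len ^ 2 := by positivity
  have hB : 0 ≤ 1 / Q.len ^ 2 := by positivity
  have hc : Continuous (dt φ) := dt_cont H.cd
  have G := halfT_BM hn ν hb
  have hbm := bnd_meas (1 / Q.len ^ 2) Q.time (Q.len ^ 2)
  have bi := bnd_integrable (T := Q.time) hB hl2
  have wm : Measurable fun t => ENNReal.ofReal (bnd (1 / Q.len ^ 2) Q.time (Q.len ^ 2) t) := by fun_prop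
  have wb : ∀ t, ENNReal.ofReal (bnd (1 / Q.len ^ 2) Q.time (Q.len ^ 2) t) ≤
      ENNReal.ofReal (5 * (1 / Q.len ^ 2) * √(Q.len ^ 2)) := fun t =>
    ENNReal.ofReal_le_ofReal (bnd_le hB hl2 t)
  have wi : ∫⁻ t, ENNReal.ofReal (bnd (1 / Q.len ^ 2) Q.time (Q.len ^ 2) t) ≠ ⊤ := by
    rw [← ofReal_integral_eq_lintegral_ofReal bi (ae_of_all _ fun t => bnd_nonneg hB t)]
    exact ENNReal.ofReal_ne_top
  have id1 := half_identity (volume : Measure (Spc n)) (convW_meas ν) (measure_ne_top (tv ν) univ)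
    (conv_lint ν) hc.measurable (fun x => (adm_nice h x).1) hB hl2 (fun x => (adm_nice h x).2.1)
    (fun x => by fun_prop) (conv_triple hn ν wm ENNReal.ofReal_ne_top wb wi)
  set ψ : Pt n → ℝ := fun p => pot (fun s => dt φ (p.1, s)) p.2 with hψ
  set g := halfT (convW ν) with hg
  have ψm : Measurable ψ := pot_joint_meas hc.measurable
  have gm := G.meas
  have id2 : ∫ p, g p * ψ p = cE * ∫ p, convW ν p * dt φ p := id1
  have ψb1 : ∀ p, ‖ψ p‖ₑ ≤ ENNReal.ofReal (bnd (1 / Q.len ^ 2) Q.time (Q.len ^ 2) p.2) := by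
    intro p
    rw [← ofReal_norm]
    exact ENNReal.ofReal_le_ofReal ((adm_nice h p.1).1.le_bnd (adm_nice h p.1).2.1 p.2)
  have ψb : ∀ p, ‖ψ p‖ₑ ≤ (Qx Q.corner Q.len).indicator (fun _ => (1:ℝ≥0∞)) p.1 *
      ENNReal.ofReal (bnd (1 / Q.len ^ 2) Q.time (Q.len ^ 2) p.2) := by
    intro p
    by_cases hp : p.1 ∈ Qx Q.corner Q.len
    · rw [indicator_of_mem hp, one_mul]; exact ψb1 p
    · have : ψ p = 0 := by
        have : ∀ s, dt φ (p.1, s) = 0 := fun s => (adm_zero h (p := (p.1, s)) (fun h' => hp h'.1)).2.2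
        simp [hψ, pot, this]
      rw [this]; simp
  have hQm := Qx_meas Q.corner Q.len
  have hIm : Measurable ((Qx Q.corner Q.len).indicator (fun _ => (1:ℝ≥0∞))) := measurable_const.indicator hQm
  have iψ : Integrable ψ := by
    refine ⟨ψm.aestronglyMeasurable, lt_of_le_of_lt (lintegral_mono ψb) ?_⟩
    rw [Measure.volume_eq_prod, lintegral_prod_mul hIm.aemeasurable wm.aemeasurable,
      lintegral_indicator hQm, setLIntegral_const, Qx_vol _ hl.le]
    exact ENNReal.mul_lt_top (by finiteness) wi.lt_top
  have igψ : Integrable (fun p => g p * ψ p) := by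
    refine ⟨(gm.mul ψm).aestronglyMeasurable,
      lt_of_le_of_lt (lintegral_mono fun p => ?_) (halfT_w hn ν wm ENNReal.ofReal_ne_top wb wi)⟩
    rw [enorm_mul]
    exact mul_le_mul_right (ψb1 p) _
  have zψ : ∫ p, ψ p = 0 := by
    rw [Measure.volume_eq_prod] at iψ ⊢
    rw [integral_prod _ iψ]
    have : ∀ x : Spc n, ∫ t, ψ (x, t) = 0 := fun x => (adm_nice h x).2.2
    simp [this]
  set m := mn g Q.corner Q.len Q.time
  have id3 : ∫ p, g p * ψ p = ∫ p, (g p - m) * ψ p := by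
    simp_rw [sub_mul]
    rw [integral_sub igψ (iψ.const_mul m), integral_const_mul, zψ, mul_zero, sub_zero]
  have fin : ‖∫ p, (g p - m) * ψ p‖ₑ ≤ ENNReal.ofReal (Sn n * Q.len ^ (n + 1)) := by
    refine (enorm_integral_le_lintegral_enorm _).trans
      ((lintegral_mono fun p => ?_).trans (G.pair Q.corner hl Q.time))
    rw [enorm_mul]
    exact mul_le_mul_right (ψb p) _
  have hS := Sn_nonneg n
  rw [← id3, id2, ← ofReal_norm, ENNReal.ofReal_le_ofReal_iff (by positivity), norm_mul,
    Real.norm_eq_abs, Real.norm_eq_abs] at fin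
  exact fin

lemma dx_term (ν : SignedMeasure (Pt n)) (hb : ∀ p, ‖convGradW ν p‖ ≤ 1)
    {φ : Pt n → ℝ} {Q : PCube n} (h : Admissible φ Q) :
    |∫ p, dx φ p (convGradW ν p)| ≤ Q.len ^ (n + 1) := by
  have hl := Q.len_pos
  have hS := St_meas Q.corner Q.len Q.time (Q.len ^ 2)
  have hv := St_vol Q.corner hl.le Q.time (Q.len ^ 2)
  have hi : Integrable ((St Q.corner Q.len Q.time (Q.len ^ 2)).indicator fun _ : Pt n => 1 / Q.len) :=
    (integrable_indicator_iff hS).2 (integrableOn_const (by rw [hv]; exact ENNReal.ofReal_ne_top))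
  have := norm_integral_le_of_norm_le (f := fun p => dx φ p (convGradW ν p)) hi (ae_of_all _ fun p => by
    by_cases hp : p ∈ St Q.corner Q.len Q.time (Q.len ^ 2)
    · rw [indicator_of_mem hp]
      refine ((dx φ p).le_opNorm _).trans ?_
      have h1 : ‖dx φ p‖ ≤ 1 / Q.len := h.2.2.1 p
      have h2 := hb p
      nlinarith [norm_nonneg (dx φ p)]
    · rw [(adm_zero h (by rw [toSet_eq]; exact hp)).2.1, indicator_of_notMem hp]
      simp)
  rw [integral_indicator hS, setIntegral_const, measureReal_def, hv,
    ENNReal.toReal_ofReal (by positivity), smul_eq_mul, Real.norm_eq_abs] at this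
  refine this.trans (le_of_eq ?_)
  field_simp
  try ring

lemma final_bound (hn : 1 ≤ n) (ν : SignedMeasure (Pt n)) (hb1 : ∀ p, ‖convGradW ν p‖ ≤ 1)
    (hb : ParabBMOLe (halfT (convW ν)) 1) (Q : PCube n) (φ : Pt n → ℝ) (h : Admissible φ Q) :
    |sInt ν φ| ≤ (1 + Sn n / |cE|) * Q.len ^ (n + 1) := by
  have H := adm_Tst h
  obtain ⟨i1, e1⟩ := rep_signed H ν
  have hc : Continuous (dt φ) := dt_cont H.cd
  have i2 : Integrable (fun p => convW ν p * dt φ p) := by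
    refine ⟨((convW_meas ν).mul hc.measurable).aestronglyMeasurable, ?_⟩
    have := fw_lint (volume : Measure (Spc n)) (convW_meas ν) (conv_lint ν)
      (slab_meas Q.time (Q.len ^ 2) (1 / Q.len ^ 2))
    refine lt_of_le_of_lt ((lintegral_mono fun p => ?_).trans this) ?_
    · rw [enorm_mul]
      exact mul_le_mul_right (H.dt_slab p) _
    · rw [slab_int]
      exact ENNReal.mul_lt_top (measure_lt_top _ _) (by finiteness)
  have i3 : Integrable (fun p => dx φ p (convGradW ν p)) := by
    refine (i1.add i2).congr (ae_of_all _ fun p => ?_)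
    simp
  rw [integral_sub i3 i2] at e1
  have h1 := dx_term ν hb1 h
  have h2 := dt_term hn ν hb h
  have hcE : 0 < |cE| := abs_pos.2 cE_neg.ne
  rw [mul_comm, ← le_div_iff₀ hcE] at h2
  rw [e1]
  refine (abs_sub _ _).trans ((add_le_add h1 h2).trans (le_of_eq ?_))
  ring

end final

/-- Lemma 3.1, measure version: growth of degree `n+1` on admissible
functions. -/
theorem growth_lemma (n : ℕ) (hn : 1 ≤ n) :
    ∃ C : ℝ, 0 < C ∧ ∀ ν : SignedMeasure (Pt n),
      (∀ p, ‖convGradW ν p‖ ≤ 1) → ParabBMOLe (halfT (convW ν)) 1 →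
      ∀ (Q : PCube n) (φ : Pt n → ℝ), Admissible φ Q →
      |sInt ν φ| ≤ C * Q.len ^ (n + 1) := by
  have hS := Sn_nonneg n
  exact ⟨1 + Sn n / |cE|, by positivity, fun ν h1 h2 Q φ h => final_bound hn ν h1 h2 Q φ h⟩
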